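/- Let g be a root-reductive Lie algebra with splitting maximal toral subalgebra h and Dynkin Borel subalgebra b ⊇ h. Let M ∈ O-bar and μ ∈ h*. The number of times L(μ) occurs as a successive quotient in a composition series of M with bounds λ and ν, where λ ≼ μ ≼ ν, is independent of the choice of the composition series and of the choice of the bounds λ, ν ∈ h* (as long as λ ≼ μ ≼ ν). This number is denoted [M : L(μ)]. -/

import Mathlib

noncomputable section
namespace Paper

variable (K : Type) [Field K] [IsAlgClosed K] [CharZero K]
variable (g : Type) [LieRing g] [LieAlgebra K g]

def adWeightSpace (h : LieSubalgebra K g) (α : Module.Dual K h) : Submodule K g where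
  carrier := {x | ∀ H : h, ⁅(H : g), x⁆ = α H • x}
  add_mem' := by intro a b ha hb H; rw [lie_add, ha H, hb H, smul_add]
  zero_mem' := by intro H; rw [lie_zero, smul_zero]
  smul_mem' := by intro c x hx H; rw [lie_smul, hx H, smul_comm]

def IsRootOf (h : LieSubalgebra K g) (α : Module.Dual K h) : Prop :=
  α ≠ 0 ∧ adWeightSpace K g h α ≠ ⊥

def IsToralIn (s t : LieSubalgebra K g) : Prop :=
  t ≤ s ∧ IsLieAbelian t ∧
    s.toSubmodule ≤ ⨆ α : Module.Dual K t, s.toSubmodule ⊓ adWeightSpace K g t α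

def IsMaxToralIn (s t : LieSubalgebra K g) : Prop :=
  IsToralIn K g s t ∧ ∀ t' : LieSubalgebra K g, IsToralIn K g s t' → t ≤ t' → t' = t

/-- A root-reductive Lie algebra `g` together with a splitting maximal toral subalgebra `h`
and a splitting Borel subalgebra `b ⊇ h` determined by a set `pos` of positive roots. -/
structure Setup where
  /-- the exhausting chain of finite-dimensional reductive subalgebras -/
  F : ℕ → LieSubalgebra K g
  F_mono : Monotone F
  F_exhaust : ∀ x : g, ∃ n, x ∈ F n
  F_findim : ∀ n, FiniteDimensional K (F n)
  /-- each `F n` is reductive: every abelian ideal is central -/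
  F_reductive : ∀ n, ∀ I : LieIdeal K (F n), IsLieAbelian I → I ≤ LieAlgebra.center K (F n)
  /-- the nested chain of Cartan subalgebras witnessing the root inclusions -/
  C : ℕ → LieSubalgebra K g
  C_mono : Monotone C
  C_le : ∀ n, C n ≤ F n
  C_cartan : ∀ n, (LieSubalgebra.comap (F n).incl (C n)).IsCartanSubalgebra
  /-- each inclusion `F n ↪ F (n+1)` is a root inclusion with respect to `C (n+1)`:
  every root space of `F n` relative to `C n` is a root space of `F (n+1)` -/
  C_rootIncl : ∀ n, ∀ α : Module.Dual K (C n), α ≠ 0 →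
    (F n).toSubmodule ⊓ adWeightSpace K g (C n) α ≠ ⊥ →
    ∃ β : Module.Dual K (C (n + 1)),
      (F n).toSubmodule ⊓ adWeightSpace K g (C n) α
        = (F (n + 1)).toSubmodule ⊓ adWeightSpace K g (C (n + 1)) β
  /-- the splitting maximal toral subalgebra -/
  h : LieSubalgebra K g
  h_maxToral : ∀ n, IsMaxToralIn K g (F n) (h ⊓ F n)
  /-- `g` is the direct sum of its `h`-weight spaces -/
  h_indep : iSupIndep fun α : Module.Dual K h => adWeightSpace K g h α
  h_span : (⨆ α : Module.Dual K h, adWeightSpace K g h α) = ⊤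
  /-- the set `Δ⁺` of positive roots -/
  pos : Set (Module.Dual K h)
  pos_root : ∀ α ∈ pos, IsRootOf K g h α
  pos_add : ∀ α ∈ pos, ∀ β ∈ pos, IsRootOf K g h (α + β) → α + β ∈ pos
  pos_polar : ∀ α : Module.Dual K h, IsRootOf K g h α → (α ∈ pos ↔ ¬(-α ∈ pos))
  neg_add : ∀ α β : Module.Dual K h, IsRootOf K g h α → IsRootOf K g h β →
    α ∉ pos → β ∉ pos → IsRootOf K g h (α + β) → α + β ∉ pos
  /-- the splitting Borel subalgebra -/
  b : LieSubalgebra K g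
  b_eq : b.toSubmodule = h.toSubmodule ⊔ ⨆ α ∈ pos, adWeightSpace K g h α


variable {K g}

namespace Setup

variable (S : Setup K g)

/-- `h ∩ g_n`. -/
def hn (n : ℕ) : LieSubalgebra K g := S.h ⊓ S.F n

/-- restriction of a functional on `h` to `h ∩ g_n`. -/
def resDual (n : ℕ) (lam : Module.Dual K S.h) : Module.Dual K (S.hn n) :=
  lam.comp (LieSubalgebra.inclusion (inf_le_left : S.hn n ≤ S.h)).toLinearMap

/-- the `α`-root space of `g_n` relative to `h ∩ g_n`. -/
def rootSpaceN (n : ℕ) (α : Module.Dual K (S.hn n)) : Submodule K g :=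
  (S.F n).toSubmodule ⊓ adWeightSpace K g (S.hn n) α

/-- the set of `b`-positive roots of `g_n`. -/
def posRootsN (n : ℕ) : Set (Module.Dual K (S.hn n)) :=
  {α | α ≠ 0 ∧ S.rootSpaceN n α ≠ ⊥ ∧ S.rootSpaceN n α ≤ S.b.toSubmodule}

/-- `ρ_n`, the half sum of the positive roots of `g_n` with respect to `b ∩ g_n`. -/
def rhoN (n : ℕ) : Module.Dual K (S.hn n) :=
  (2 : K)⁻¹ • ∑ᶠ α ∈ S.posRootsN n, α

/-- `α` is a simple `b`-positive root: it is positive and cannot be written as a sum of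
two or more positive roots. -/
def IsSimpleRoot (α : Module.Dual K S.h) : Prop :=
  α ∈ S.pos ∧ ¬∃ s : Multiset (Module.Dual K S.h),
    2 ≤ Multiset.card s ∧ (∀ β ∈ s, β ∈ S.pos) ∧ s.sum = α

/-- `b` is a Dynkin Borel subalgebra: it is generated, as a Lie subalgebra, by `h` together
with the simple root spaces. -/
def IsDynkin : Prop :=
  S.b = LieSubalgebra.lieSpan K g
    ((S.h : Set g) ∪ ⋃ α ∈ {α | S.IsSimpleRoot α}, (adWeightSpace K g S.h α : Set g))

/-- the partial order `≼` on `h^*`: `lam ≼ mu` iff `mu - lam` is a `ℤ≥0`-linear combination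
of positive roots. -/
def wle (lam mu : Module.Dual K S.h) : Prop :=
  ∃ s : Multiset (Module.Dual K S.h), (∀ β ∈ s, β ∈ S.pos) ∧ mu - lam = s.sum

/-- `g` is locally semisimple: each `g_n` is a semisimple Lie algebra. -/
def IsLocallySemisimple : Prop := ∀ n, LieAlgebra.IsSemisimple K (S.F n)

end Setup


/-- the universal enveloping algebra of `g`. -/
abbrev Env (K g : Type) [Field K] [LieRing g] [LieAlgebra K g] : Type :=
  UniversalEnvelopingAlgebra K g

namespace Setup

variable {K : Type} [Field K] [IsAlgClosed K] [CharZero K]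
variable {g : Type} [LieRing g] [LieAlgebra K g]
variable (S : Setup K g)

/-- the nilpotent radical `n⁺ = ⨁_{α ∈ Δ⁺} g^α` of `b`, as a subspace of `g`. -/
def nplus : Submodule K g := ⨆ α ∈ S.pos, adWeightSpace K g S.h α

/-- the left ideal of `U(g)` generated by `n⁺` and the elements `H - lam(H)`, `H ∈ h`. -/
def vermaIdeal (lam : Module.Dual K S.h) : Submodule (Env K g) (Env K g) :=
  Submodule.span (Env K g)
    ((UniversalEnvelopingAlgebra.ι K '' (S.nplus : Set g)) ∪
      Set.range fun H : S.h =>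
        UniversalEnvelopingAlgebra.ι K (H : g) - algebraMap K (Env K g) (lam H))

/-- the Verma module `M(lam) = U(g)/I`. -/
abbrev Verma (lam : Module.Dual K S.h) : Type := Env K g ⧸ S.vermaIdeal lam

/-- the maximal proper submodule of the Verma module `M(lam)`,
i.e. the sum of all proper submodules. -/
def maxSub (lam : Module.Dual K S.h) : Submodule (Env K g) (S.Verma lam) :=
  sSup {N : Submodule (Env K g) (S.Verma lam) | N ≠ ⊤}

/-- the simple module `L(lam)`, the unique simple quotient of `M(lam)`. -/
abbrev SimpleL (lam : Module.Dual K S.h) : Type := S.Verma lam ⧸ S.maxSub lam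

/-- `H` is the coroot `h_α` of the root `α`:  `α(H) = 2` and `H ∈ [g^α, g^{-α}]`. -/
def IsCoroot (α : Module.Dual K S.h) (H : S.h) : Prop :=
  α H = 2 ∧ ∃ x ∈ adWeightSpace K g S.h α, ∃ y ∈ adWeightSpace K g S.h (-α),
    (H : g) = ⁅x, y⁆

/-- the dot-reflection `s_α · mu = mu - (mu + ρ)(h_α) α` associated to a root `α`
with coroot `Hα`, relative to the half sum `ρ` of positive roots. -/
def dotReflect (ρ α : Module.Dual K S.h) (Hα : S.h) (mu : Module.Dual K S.h) :
    Module.Dual K S.h :=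
  mu - ((mu + ρ) Hα) • α

/-- `ρ` is the global half sum of positive roots: its restriction to each `h ∩ g_n`
is the half sum `ρ_n` of positive roots of `g_n`. -/
def IsGlobalRho (ρ : Module.Dual K S.h) : Prop := ∀ n : ℕ, S.resDual n ρ = S.rhoN n

/-- `lam` is strongly linked to `mu` (relative to `ρ`). -/
inductive StronglyLinked (ρ : Module.Dual K S.h) :
    Module.Dual K S.h → Module.Dual K S.h → Prop
  | refl (mu : Module.Dual K S.h) : StronglyLinked ρ mu mu
  | step {lam mu : Module.Dual K S.h} (α : Module.Dual K S.h) (Hα : S.h) :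
      α ∈ S.pos → S.IsCoroot α Hα →
      S.wle (S.dotReflect ρ α Hα mu) mu →
      StronglyLinked ρ lam (S.dotReflect ρ α Hα mu) →
      StronglyLinked ρ lam mu

/-- `lam` is antidominant: `(lam + ρ)(h_α)` is not a positive integer
for any positive root `α`. -/
def IsAntidominant (ρ lam : Module.Dual K S.h) : Prop :=
  ∀ α ∈ S.pos, ∀ Hα : S.h, S.IsCoroot α Hα → ¬∃ k : ℕ, 0 < k ∧ (lam + ρ) Hα = (k : K)

/-- `lam` is almost antidominant: `(lam + ρ)(h_α)` is a positive integer
for only finitely many positive roots `α`. -/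
def IsAlmostAntidominant (ρ lam : Module.Dual K S.h) : Prop :=
  {α | α ∈ S.pos ∧ ∃ Hα : S.h, S.IsCoroot α Hα ∧
    ∃ k : ℕ, 0 < k ∧ (lam + ρ) Hα = (k : K)}.Finite

end Setup

namespace Setup

variable {K : Type} [Field K] [IsAlgClosed K] [CharZero K]
variable {g : Type} [LieRing g] [LieAlgebra K g]
variable (S : Setup K g)

/-- the reflection `s_α : mu ↦ mu - mu(h_α) α`, as a linear map on `h^*`. -/
def reflectionMap (α : Module.Dual K S.h) (Hα : S.h) :
    Module.Dual K S.h →ₗ[K] Module.Dual K S.h where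
  toFun mu := mu - mu Hα • α
  map_add' mu ν := by
    simp only [LinearMap.add_apply, add_smul]
    abel
  map_smul' c mu := by
    simp only [LinearMap.smul_apply, RingHom.id_apply, smul_sub, smul_smul, smul_eq_mul]

/-- the reflection `s_α` associated to a root `α` with coroot `Hα`,
as a linear automorphism of `h^*`. -/
def reflection (α : Module.Dual K S.h) (Hα : S.h) (h2 : α Hα = 2) :
    Module.Dual K S.h ≃ₗ[K] Module.Dual K S.h :=
  LinearEquiv.ofInvolutive (S.reflectionMap α Hα) (by
    intro mu
    show S.reflectionMap α Hα (mu - mu Hα • α) = mu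
    show (mu - mu Hα • α) - ((mu - mu Hα • α) Hα) • α = mu
    rw [LinearMap.sub_apply, LinearMap.smul_apply, h2, smul_eq_mul]
    module)

/-- the Weyl group of `g`, realized as the group of linear automorphisms of `h^*`
generated by the reflections in the roots. -/
def weylGroup : Subgroup (Module.Dual K S.h ≃ₗ[K] Module.Dual K S.h) :=
  Subgroup.closure
    {w | ∃ (α : Module.Dual K S.h) (Hα : S.h) (hc : S.IsCoroot α Hα),
      IsRootOf K g S.h α ∧ w = S.reflection α Hα hc.1}

/-- the dot action `w · mu = w(mu + ρ) - ρ`. -/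
def dotAct (ρ : Module.Dual K S.h) (w : Module.Dual K S.h ≃ₗ[K] Module.Dual K S.h)
    (mu : Module.Dual K S.h) : Module.Dual K S.h :=
  w (mu + ρ) - ρ

/-- the root lattice `Λ`, the `ℤ`-span of the roots in `h^*`. -/
def rootLattice : Submodule ℤ (Module.Dual K S.h) :=
  Submodule.span ℤ {α : Module.Dual K S.h | IsRootOf K g S.h α}

end Setup

variable {K : Type} [Field K] [IsAlgClosed K] [CharZero K]
variable {g : Type} [LieRing g] [LieAlgebra K g]

lemma env_smul_comm {M : Type} [AddCommGroup M] [Module K M] [Module (Env K g) M]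
    [IsScalarTower K (Env K g) M] (c : K) (r : Env K g) (m : M) :
    r • (c • m) = c • (r • m) := by
  rw [← algebraMap_smul (Env K g) c m, ← mul_smul, ← Algebra.commutes, mul_smul,
    algebraMap_smul]

namespace Setup

variable (S : Setup K g)

section Modules

variable (M : Type) [AddCommGroup M] [Module K M] [Module (Env K g) M]
  [IsScalarTower K (Env K g) M]

/-- the `lam`-weight space of a `U(g)`-module `M`. -/
def wtSpace (lam : Module.Dual K S.h) : Submodule K M where
  carrier := {m | ∀ H : S.h, UniversalEnvelopingAlgebra.ι K (H : g) • m = lam H • m}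
  add_mem' := by
    intro a b ha hb H
    rw [smul_add, ha H, hb H, smul_add]
  zero_mem' := by
    intro H
    rw [smul_zero, smul_zero]
  smul_mem' := by
    intro c x hx H
    rw [env_smul_comm, hx H, smul_comm]

/-- the support of `M`: the set of `h`-weights of `M`. -/
def support : Set (Module.Dual K S.h) := {lam | S.wtSpace M lam ≠ ⊥}

/-- `M` is an object of the extended category `O-bar`:  it is an `h`-weight module with
finite-dimensional weight spaces and `U(n⁺) ⬝ v` is finite dimensional for every `v ∈ M`. -/
structure InO : Prop where
  indep : iSupIndep fun lam : Module.Dual K S.h => S.wtSpace M lam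
  span : (⨆ lam : Module.Dual K S.h, S.wtSpace M lam) = ⊤
  finite : ∀ lam : Module.Dual K S.h, FiniteDimensional K (S.wtSpace M lam)
  locFin : ∀ v : M, ∃ N : Submodule K M, FiniteDimensional K N ∧ v ∈ N ∧
    ∀ x ∈ S.nplus, ∀ m ∈ N, UniversalEnvelopingAlgebra.ι K x • m ∈ N

end Modules

end Setup

/-- a `U(g)`-module is indecomposable if it is nonzero and is not the direct sum of two
nonzero submodules. -/
def Indecomposable (M : Type) [AddCommGroup M] [Module (Env K g) M] : Prop :=
  (⊤ : Submodule (Env K g) M) ≠ ⊥ ∧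
    ∀ N₁ N₂ : Submodule (Env K g) M, IsCompl N₁ N₂ → N₁ = ⊥ ∨ N₂ = ⊥

/-- the subquotient `N₂ / N₁` of a pair of submodules. -/
abbrev subQuot {M : Type} [AddCommGroup M] [Module (Env K g) M]
    (N₁ N₂ : Submodule (Env K g) M) : Type :=
  N₂ ⧸ (N₁.comap N₂.subtype)

namespace Setup

variable (S : Setup K g)

/-- A composition series of `M` with bounds `lam ≼ nu`: a finite filtration of `M` together
with a relevant index set `J` such that relevant subquotients are simple modules `L(ξ)` with
`lam ≼ ξ ≼ nu`, and irrelevant subquotients either have no weights in the interval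
`[lam, nu]` or are simple modules `L(ξ)` with `ξ ≻ lam` and `ξ ⋠ nu`. -/
structure CompSeries (lam nu : Module.Dual K S.h) (M : Type) [AddCommGroup M] [Module K M]
    [Module (Env K g) M] [IsScalarTower K (Env K g) M] where
  k : ℕ
  c : Fin (k + 1) → Submodule (Env K g) M
  mono : Monotone c
  bot : c 0 = ⊥
  top : c (Fin.last k) = ⊤
  J : Finset (Fin k)
  rel : ∀ j ∈ J, ∃ ξ : Module.Dual K S.h, S.wle lam ξ ∧ S.wle ξ nu ∧
    Nonempty (subQuot (c j.castSucc) (c j.succ) ≃ₗ[Env K g] S.SimpleL ξ)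
  irrel : ∀ j : Fin k, j ∉ J →
    (∀ mu : Module.Dual K S.h, S.wle lam mu → S.wle mu nu →
        S.wtSpace (subQuot (c j.castSucc) (c j.succ)) mu = ⊥) ∨
    (∃ ξ : Module.Dual K S.h, S.wle lam ξ ∧ ξ ≠ lam ∧ ¬S.wle ξ nu ∧
        Nonempty (subQuot (c j.castSucc) (c j.succ) ≃ₗ[Env K g] S.SimpleL ξ))

/-- the `j`-th subquotient of a composition series. -/
abbrev CompSeries.quot {S : Setup K g} {lam nu : Module.Dual K S.h} {M : Type}
    [AddCommGroup M] [Module K M] [Module (Env K g) M] [IsScalarTower K (Env K g) M]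
    (T : S.CompSeries lam nu M) (j : Fin T.k) : Type :=
  subQuot (T.c j.castSucc) (T.c j.succ)

/-- the number of times the simple module `L(mu)` occurs in the composition series `T`. -/
noncomputable def CompSeries.mult {S : Setup K g} {lam nu : Module.Dual K S.h} {M : Type}
    [AddCommGroup M] [Module K M] [Module (Env K g) M] [IsScalarTower K (Env K g) M]
    (T : S.CompSeries lam nu M) (mu : Module.Dual K S.h) : ℕ :=
  Nat.card {j : Fin T.k // j ∈ T.J ∧ Nonempty (T.quot j ≃ₗ[Env K g] S.SimpleL mu)}

/-- `L(mu)` is a composition factor of `M`: it occurs in some composition series of `M`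
with bounds `lam ≼ mu ≼ nu`. -/
def IsCompFactor (M : Type) [AddCommGroup M] [Module K M] [Module (Env K g) M]
    [IsScalarTower K (Env K g) M] (mu : Module.Dual K S.h) : Prop :=
  ∃ (lam nu : Module.Dual K S.h) (T : S.CompSeries lam nu M),
    S.wle lam mu ∧ S.wle mu nu ∧
    ∃ j ∈ T.J, Nonempty (T.quot j ≃ₗ[Env K g] S.SimpleL mu)

end Setup

/-- A generalized composition series of `M`: a family of submodules indexed by a totally
ordered set `(J, <)`, strictly increasing, with trivial intersection, union equal to `M`,
and all subquotients `M_j / M_{<j}` simple. -/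
structure GenCompSeries (M : Type) [AddCommGroup M] [Module (Env K g) M] where
  J : Type
  lt : J → J → Prop
  linear : IsLinearOrder J lt
  c : J → Submodule (Env K g) M
  strict : ∀ {i j : J}, lt i j → c i < c j
  iInf_bot : (⨅ j, c j) = ⊥
  iSup_top : (⨆ j, c j) = ⊤
  simple : ∀ j : J,
    IsSimpleModule (Env K g) (subQuot (⨆ i : {i : J // lt i j}, c i) (c j))

/-- the subquotient `M_j / M_{<j}` of a generalized composition series. -/
abbrev GenCompSeries.quot {M : Type} [AddCommGroup M] [Module (Env K g) M]
    (T : GenCompSeries (K := K) (g := g) M) (j : T.J) : Type :=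
  subQuot (⨆ i : {i : T.J // T.lt i j}, T.c i) (T.c j)

set_option linter.unusedSectionVars false

section Isotropic

open LieAlgebra Module.End

variable {K : Type*} [Field K] {L : Type*} [LieRing L] [LieAlgebra K L]

/-- Every abelian ideal is central. -/
def AbelianCentral (K L : Type*) [Field K] [LieRing L] [LieAlgebra K L] : Prop :=
  ∀ I : LieIdeal K L, IsLieAbelian I → I ≤ LieAlgebra.center K L

lemma AbelianCentral.le_center (hP : AbelianCentral K L) (I : LieIdeal K L)
    (hI : ∀ x ∈ I, ∀ y ∈ I, ⁅x, y⁆ = 0) : I ≤ LieAlgebra.center K L :=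
  hP I ⟨fun x y => Subtype.ext (hI x x.2 y y.2)⟩

lemma mem_center_iff' {x : L} : x ∈ LieAlgebra.center K L ↔ ∀ y : L, ⁅x, y⁆ = 0 := by
  rw [LieModule.mem_maxTrivSubmodule]
  refine forall_congr' fun y => ?_
  rw [← lie_skew, neg_eq_zero]

lemma lie_center_eq_zero {z : L} (hz : z ∈ LieAlgebra.center K L) (x : L) : ⁅x, z⁆ = 0 :=
  (LieModule.mem_maxTrivSubmodule K L L z).mp hz x

lemma AbelianCentral.lie_le_center [FiniteDimensional K L] (hP : AbelianCentral K L)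
    (N : LieIdeal K L) (hN : ∀ x ∈ N, IsNilpotent (ad K L x)) :
    ⁅N, N⁆ ≤ LieAlgebra.center K L := by
  have hnil : LieModule.IsNilpotent N L := by
    rw [LieModule.isNilpotent_iff_forall' (R := K)]
    rintro ⟨x, hx⟩
    exact hN x hx
  set δ : ℕ → LieIdeal K L := fun k => (fun J : LieIdeal K L => ⁅N, J⁆)^[k] N with hδ
  have hsucc (k : ℕ) : δ (k + 1) = ⁅N, δ k⁆ := Function.iterate_succ_apply' _ _ _
  have hle (k : ℕ) : δ k ≤ N.lcs L k := by
    induction k with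
    | zero => simp
    | succ k ih =>
      rw [hsucc, LieIdeal.lcs_succ]
      exact LieSubmodule.mono_lie_right _ ih
  obtain ⟨k, hk⟩ := (LieModule.isNilpotent_iff K N L).mp hnil
  have hbot : δ k ≤ LieAlgebra.center K L := by
    refine (hle k).trans ?_
    have h := LieIdeal.coe_lcs_eq (R := K) N L k
    rw [hk, LieSubmodule.bot_toSubmodule, LieSubmodule.toSubmodule_eq_bot] at h
    rw [h]
    exact bot_le
  have hle1 (k : ℕ) : δ (k + 1) ≤ ⁅N, N⁆ := by
    rw [hsucc]
    refine LieSubmodule.mono_lie_right _ ?_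
    induction k with
    | zero => exact le_rfl
    | succ k ih => rw [hsucc]; exact LieSubmodule.lie_le_right _ _ |>.trans ih
  have key : ∀ j : ℕ, δ (j + 1) ≤ LieAlgebra.center K L → δ 1 ≤ LieAlgebra.center K L := by
    intro j
    induction j with
    | zero => exact id
    | succ j ih =>
      intro hj
      refine ih (hP.le_center _ fun x hx y hy => ?_)
      have hy' : y ∈ ⁅N, N⁆ := hle1 j hy
      clear hy
      rw [← LieSubmodule.mem_toSubmodule, LieSubmodule.lieIdeal_oper_eq_linear_span'] at hy'
      induction hy' using Submodule.span_induction with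
      | mem y hy =>
        obtain ⟨a, ha, b, hb, rfl⟩ := hy
        have hc (c : L) (hc : c ∈ N) : ⁅x, c⁆ ∈ LieAlgebra.center K L := by
          refine hj ?_
          rw [hsucc, LieSubmodule.lie_comm]
          exact LieSubmodule.lie_mem_lie hx hc
        rw [leibniz_lie, mem_center_iff'.mp (hc a ha), ← lie_skew,
          mem_center_iff'.mp (hc b hb)]
        simp
      | zero => simp
      | add y z _ _ hy hz => rw [lie_add, hy, hz, add_zero]
      | smul c y _ hy => rw [lie_smul, hy, smul_zero]
  refine key k ?_
  rw [hsucc]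
  exact (LieSubmodule.lie_le_right _ _).trans hbot

/-- A subspace of a generalized eigenspace for a nonzero eigenvalue lies in any subspace
containing its image. -/
lemma le_of_le_maxGenEigenspace {V : Type*} [AddCommGroup V] [Module K V]
    (f : Module.End K V) {a : K} (ha : a ≠ 0) (E W : Submodule K V)
    (hE : E ≤ f.maxGenEigenspace a) (hEf : ∀ y ∈ E, f y ∈ E) (hEW : ∀ y ∈ E, f y ∈ W) :
    E ≤ W := by
  intro y hy
  obtain ⟨k, hk⟩ := mem_maxGenEigenspace f a y |>.mp (hE hy)
  have : ((f - a • 1) ^ k) y ∈ W := by rw [hk]; exact W.zero_mem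
  clear hk
  induction k generalizing y with
  | zero => simpa using this
  | succ k ih =>
    have h1 : (f - a • 1) y ∈ E := by
      simpa using E.sub_mem (hEf y hy) (E.smul_mem a hy)
    rw [pow_succ, Module.End.mul_apply] at this
    have h2 := ih h1 this
    have h3 : a • y ∈ W := by
      have := W.sub_mem (hEW y hy) h2
      simpa using this
    exact (W.smul_mem_iff ha).mp h3

lemma isNilpotent_of_maxGenEigenspace_eq_bot [IsAlgClosed K] {V : Type*} [AddCommGroup V]
    [Module K V] [FiniteDimensional K V] (f : Module.End K V)
    (h : ∀ a : K, a ≠ 0 → f.maxGenEigenspace a = ⊥) : IsNilpotent f := by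
  have h1 := iSup_maxGenEigenspace_eq_top f
  have h2 : f.maxGenEigenspace 0 = ⊤ := by
    rw [eq_top_iff, ← h1]
    refine iSup_le fun a => ?_
    by_cases ha : a = 0
    · rw [ha]
    · rw [h a ha]; exact bot_le
  refine Module.End.isNilpotent_iff_of_finite.mpr fun v => ?_
  have := (mem_maxGenEigenspace f 0 v).mp (h2 ▸ Submodule.mem_top)
  simpa using this

lemma disjoint_maxGenEigenspace' {V : Type*} [AddCommGroup V]
    [Module K V] (f : Module.End K V) {a b : K} (hab : a ≠ b) {y : V}
    (ha : y ∈ f.maxGenEigenspace a) (hb : y ∈ f.maxGenEigenspace b) : y = 0 := by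
  have := Module.End.disjoint_genEigenspace f hab ⊤ ⊤
  exact (Submodule.disjoint_def.mp this) y ha hb

lemma mem_maxGenEigenspace_zero_of_apply_eq_zero {V : Type*} [AddCommGroup V]
    [Module K V] (f : Module.End K V) {y : V} (h : f y = 0) : y ∈ f.maxGenEigenspace 0 :=
  (mem_maxGenEigenspace f 0 y).mpr ⟨1, by simpa using h⟩

lemma AbelianCentral.isNilpotent_ad [IsAlgClosed K] [CharZero K] [FiniteDimensional K L]
    (hP : AbelianCentral K L) (k : ℕ) (I : LieIdeal K L)
    (hI : derivedSeriesOfIdeal K L k I = ⊥) (x : L) (hx : x ∈ I) : IsNilpotent (ad K L x) := by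
  induction k generalizing I x with
  | zero =>
    rw [derivedSeriesOfIdeal_zero] at hI
    rw [hI, LieSubmodule.mem_bot] at hx
    simp [hx]
  | succ k ih =>
    set D : LieIdeal K L := ⁅I, I⁆ with hD
    have hDnil : ∀ x ∈ D, IsNilpotent (ad K L x) := by
      refine ih D ?_
      rw [derivedSeriesOfIdeal_add] at hI
      simpa [derivedSeriesOfIdeal_succ] using hI
    have hDZ := hP.lie_le_center D hDnil
    set E : K → Submodule K L := fun a => (ad K L x).maxGenEigenspace a with hE
    have hEmul {a b : K} {y z : L} (hy : y ∈ E a) (hz : z ∈ E b) : ⁅y, z⁆ ∈ E (a + b) :=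
      LieModule.lie_mem_maxGenEigenspace_toEnd hy hz
    have hEstab (a : K) : ∀ y ∈ E a, (ad K L x) y ∈ E a := fun y hy =>
      Module.End.mapsTo_maxGenEigenspace_of_comm (Commute.refl _) a hy
    have hEI {a : K} (ha : a ≠ 0) : E a ≤ I.toSubmodule :=
      le_of_le_maxGenEigenspace _ ha _ _ le_rfl (hEstab a) fun y _ => lie_mem_left _ _ _ _ _ hx
    have hED {a : K} (ha : a ≠ 0) : E a ≤ D.toSubmodule :=
      le_of_le_maxGenEigenspace _ ha _ _ le_rfl (hEstab a) fun y hy =>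
        LieSubmodule.lie_mem_lie hx (hEI ha hy)
    have hZ0 {z : L} (hz : z ∈ LieAlgebra.center K L) : z ∈ E 0 :=
      mem_maxGenEigenspace_zero_of_apply_eq_zero _ (lie_center_eq_zero hz x)
    have hDD {y z : L} (hy : y ∈ D) (hz : z ∈ D) : ⁅y, z⁆ ∈ LieAlgebra.center K L :=
      hDZ (LieSubmodule.lie_mem_lie hy hz)
    refine isNilpotent_of_maxGenEigenspace_eq_bot _ fun a ha => ?_
    let J : LieIdeal K L :=
      { E a ⊔ (LieAlgebra.center K L).toSubmodule with
        lie_mem := by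
          intro z y hy
          change y ∈ E a ⊔ (LieAlgebra.center K L).toSubmodule at hy
          change ⁅z, y⁆ ∈ E a ⊔ (LieAlgebra.center K L).toSubmodule
          obtain ⟨u, hu, v, hv, rfl⟩ := Submodule.mem_sup.mp hy
          rw [lie_add, lie_center_eq_zero hv z, add_zero]
          have hz : z ∈ ⨆ b, E b := by
            rw [iSup_maxGenEigenspace_eq_top]; trivial
          induction hz using Submodule.iSup_induction' with
          | mem b z hz =>
            by_cases hb : b = 0
            · subst hb
              refine Submodule.mem_sup_left ?_
              simpa using hEmul hz hu
            · exact Submodule.mem_sup_right (hDD (hED hb hz) (hED ha hu))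
          | zero => simp
          | add z w _ _ hz hw => rw [add_lie]; exact Submodule.add_mem _ hz hw }
    have hJ : J ≤ LieAlgebra.center K L := by
      refine hP.le_center J fun y hy z hz => ?_
      change y ∈ E a ⊔ (LieAlgebra.center K L).toSubmodule at hy
      change z ∈ E a ⊔ (LieAlgebra.center K L).toSubmodule at hz
      obtain ⟨y, hy', v, hv, rfl⟩ := Submodule.mem_sup.mp hy
      obtain ⟨z, hz', w, hw, rfl⟩ := Submodule.mem_sup.mp hz
      rw [lie_add, lie_center_eq_zero hw, add_zero, add_lie,
        mem_center_iff'.mp hv, add_zero]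
      refine disjoint_maxGenEigenspace' (ad K L x) (a := 0) (b := a + a) ?_ ?_ (hEmul hy' hz')
      · intro h
        exact ha (by simpa using h.symm)
      · exact hZ0 (hDD (hED ha hy') (hED ha hz'))
    rw [Submodule.eq_bot_iff]
    intro y hy
    exact disjoint_maxGenEigenspace' (ad K L x) ha hy
      (hZ0 (hJ (show y ∈ E a ⊔ _ from Submodule.mem_sup_left hy)))

lemma AbelianCentral.radical_lie_le_center [IsAlgClosed K] [CharZero K] [FiniteDimensional K L]
    (hP : AbelianCentral K L) :
    ⁅radical K L, radical K L⁆ ≤ LieAlgebra.center K L := by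
  have : IsSolvable (radical K L) := inferInstance
  obtain ⟨k, hk⟩ := (isSolvable_iff K _).mp this
  rw [LieIdeal.derivedSeries_eq_bot_iff] at hk
  exact hP.lie_le_center _ (hP.isNilpotent_ad k _ hk)

end Isotropic

section Spanning

open LieAlgebra Module.End

variable {K : Type*} [Field K] {L : Type*} [LieRing L] [LieAlgebra K L]
  {V : Type*} [AddCommGroup V] [Module K V]

/-- The span of the vectors obtained from `u` by applying at most `k` operators from `𝔫`. -/
def wordSpan (ρ : L →ₗ[K] Module.End K V) (𝔫 : Submodule K L) (u : V) : ℕ → Submodule K V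
  | 0 => Submodule.span K {u}
  | k + 1 => wordSpan ρ 𝔫 u k ⊔
      Submodule.span K {z | ∃ n ∈ 𝔫, ∃ w ∈ wordSpan ρ 𝔫 u k, z = ρ n w}

lemma wordSpan_succ_of_mem (ρ : L →ₗ[K] Module.End K V) (𝔫 : Submodule K L) (u : V) (k : ℕ)
    {n : L} (hn : n ∈ 𝔫) {w : V} (hw : w ∈ wordSpan ρ 𝔫 u k) :
    ρ n w ∈ wordSpan ρ 𝔫 u (k + 1) :=
  Submodule.mem_sup_right (Submodule.subset_span ⟨n, hn, w, hw, rfl⟩)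

/-- If `L = 𝔫 + 𝔟` and `u` is a common eigenvector of `𝔟`, then the smallest subspace containing
`u` and stable under `𝔫` is stable under `L`. -/
lemma exists_stable_submodule (ρ : L →ₗ[K] Module.End K V)
    (hρ : ∀ x y v, ρ ⁅x, y⁆ v = ρ x (ρ y v) - ρ y (ρ x v)) (𝔫 𝔟 : Submodule K L)
    (h : 𝔫 ⊔ 𝔟 = ⊤) (u : V) (hu : ∀ y ∈ 𝔟, ∃ c : K, ρ y u = c • u) (W : Submodule K V)
    (huW : u ∈ W) (hW : ∀ y ∈ 𝔫, ∀ w ∈ W, ρ y w ∈ W) :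
    ∃ X : Submodule K V, u ∈ X ∧ X ≤ W ∧ ∀ y, ∀ x ∈ X, ρ y x ∈ X := by
  have hmono : Monotone (wordSpan ρ 𝔫 u) := monotone_nat_of_le_succ fun k => le_sup_left
  have hle (k : ℕ) : wordSpan ρ 𝔫 u k ≤ W := by
    induction k with
    | zero => simpa [wordSpan] using huW
    | succ k ih =>
      refine sup_le ih (Submodule.span_le.mpr ?_)
      rintro _ ⟨n, hn, w, hw, rfl⟩
      exact hW n hn w (ih hw)
  have hb (k : ℕ) : ∀ y ∈ 𝔟, ∀ x ∈ wordSpan ρ 𝔫 u k, ρ y x ∈ wordSpan ρ 𝔫 u k := by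
    induction k with
    | zero =>
      intro y hy x hx
      obtain ⟨a, rfl⟩ := Submodule.mem_span_singleton.mp hx
      obtain ⟨c, hc⟩ := hu y hy
      rw [map_smul, hc]
      exact Submodule.smul_mem _ _ (Submodule.smul_mem _ _ (Submodule.mem_span_singleton_self u))
    | succ k ih =>
      intro y hy x hx
      obtain ⟨x₁, h₁, x₂, h₂, rfl⟩ := Submodule.mem_sup.mp hx
      rw [map_add]
      refine Submodule.add_mem _ (hmono k.le_succ (ih y hy x₁ h₁)) ?_
      clear hx
      induction h₂ using Submodule.span_induction with
      | mem x hx =>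
        obtain ⟨n, hn, w, hw, rfl⟩ := hx
        have h1 : ρ y (ρ n w) = ρ ⁅y, n⁆ w + ρ n (ρ y w) := by
          rw [hρ]
          abel
        rw [h1]
        obtain ⟨p, hp, q, hq, hpq⟩ := Submodule.mem_sup.mp (show ⁅y, n⁆ ∈ 𝔫 ⊔ 𝔟 by rw [h]; trivial)
        rw [← hpq, map_add, LinearMap.add_apply]
        exact Submodule.add_mem _ (Submodule.add_mem _ (wordSpan_succ_of_mem ρ 𝔫 u k hp hw)
          (hmono k.le_succ (ih q hq w hw))) (wordSpan_succ_of_mem ρ 𝔫 u k hn (ih y hy w hw))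
      | zero => simp
      | add a b _ _ ha hb => rw [map_add]; exact Submodule.add_mem _ ha hb
      | smul c a _ ha => rw [map_smul]; exact Submodule.smul_mem _ _ ha
  refine ⟨⨆ k, wordSpan ρ 𝔫 u k, ?_, iSup_le hle, fun y x hx => ?_⟩
  · exact Submodule.mem_iSup_of_mem 0 (Submodule.mem_span_singleton_self u)
  · obtain ⟨k, hk⟩ := (Submodule.mem_iSup_of_directed _ hmono.directed_le).mp hx
    obtain ⟨p, hp, q, hq, rfl⟩ := Submodule.mem_sup.mp (show y ∈ 𝔫 ⊔ 𝔟 by rw [h]; trivial)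
    rw [map_add, LinearMap.add_apply]
    exact Submodule.add_mem _ (Submodule.mem_iSup_of_mem (k + 1) (wordSpan_succ_of_mem ρ 𝔫 u k hp hk))
      (Submodule.mem_iSup_of_mem k (hb k q hq x hk))

end Spanning

section Principal

open LieModule

variable {K : Type*} [Field K] {L : Type*} [LieRing L] [LieAlgebra K L]
  {V : Type*} [AddCommGroup V] [Module K V] [LieRingModule L V] [LieModule K L V]

lemma lie_mem_eigenspace {h x : L} {v : V} {a b : K} (hx : ⁅h, x⁆ = a • x)
    (hv : ⁅h, v⁆ = b • v) : ⁅h, ⁅x, v⁆⁆ = (a + b) • ⁅x, v⁆ := by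
  rw [leibniz_lie, hx, hv, smul_lie, lie_smul, add_smul]

lemma exists_common_eigenvector [CharZero K] [IsAlgClosed K] [FiniteDimensional K V] (H : LieSubalgebra K L) [IsLieAbelian H]
    (E : Submodule K V) (hE : E ≠ ⊥) (hstab : ∀ x ∈ H, ∀ v ∈ E, ⁅x, v⁆ ∈ E) :
    ∃ u ∈ E, u ≠ 0 ∧ ∀ x ∈ H, ∃ c : K, ⁅x, u⁆ = c • u := by
  let E' : LieSubmodule K H V := { E with lie_mem := fun {x v} hv => hstab x x.2 v hv }
  have : Nontrivial E' := (Submodule.nontrivial_iff_ne_bot (p := E)).mpr hE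
  obtain ⟨χ, hχ⟩ := exists_nontrivial_weightSpace_of_isSolvable K H E'
  obtain ⟨u, hu⟩ := exists_ne (0 : weightSpace E' χ)
  refine ⟨u.1, u.1.2, ?_, fun x hx => ⟨χ ⟨x, hx⟩, ?_⟩⟩
  · intro h0
    exact hu (Subtype.ext (Subtype.ext h0))
  · have := (mem_weightSpace χ u.1).mp u.2 ⟨x, hx⟩
    exact congrArg Subtype.val this

lemma toEnd_pow_symm_apply [CharZero K] {h e f : L} (t : IsSl2Triple h e f) {w : V} {m : ℕ}
    (P : t.symm.HasPrimitiveVectorWith w (m : K)) (j : ℕ) (hj : j ≤ m) :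
    ∃ C : K, C ≠ 0 ∧ ((toEnd K L V f) ^ j) (((toEnd K L V e) ^ j) w) = C • w := by
  induction j with
  | zero => exact ⟨1, one_ne_zero, by simp⟩
  | succ j ih =>
    obtain ⟨C, hC, h⟩ := ih (by omega)
    have h1 := P.lie_e_pow_succ_toEnd_f j
    refine ⟨((j + 1) * ((m : K) - j)) * C, mul_ne_zero (mul_ne_zero ?_ ?_) hC, ?_⟩
    · exact_mod_cast j.succ_ne_zero
    · rw [sub_ne_zero]; exact_mod_cast (by omega)
    · rw [pow_succ, Module.End.mul_apply, toEnd_apply_apply, h1, map_smul, h, smul_smul]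

lemma bilin_pow_toEnd {Z : Type*} [AddCommGroup Z] [Module K Z] (B : V →ₗ[K] V →ₗ[K] Z)
    (hB : ∀ (x : L) (v w : V), B ⁅x, v⁆ w + B v ⁅x, w⁆ = 0) (f : L) (j : ℕ) (v w : V) :
    B v (((toEnd K L V f) ^ j) w) = (-1) ^ j • B (((toEnd K L V f) ^ j) v) w := by
  induction j generalizing v with
  | zero => simp
  | succ j ih =>
    have h1 := hB f v (((toEnd K L V f) ^ j) w)
    rw [pow_succ', Module.End.mul_apply, toEnd_apply_apply, ← neg_eq_of_add_eq_zero_right h1, ih,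
      ← toEnd_apply_apply K L V f v, ← Module.End.mul_apply, ← pow_succ, ← pow_succ', pow_succ (-1)]
    simp

end Principal

section Principal

open LieAlgebra LieModule Module.End

variable {K : Type*} [Field K] {L : Type*} [LieRing L] [LieAlgebra K L]
  {V : Type*} [AddCommGroup V] [Module K V] [LieRingModule L V] [LieModule K L V]

variable (K L V) in
/-- The action of `L` on `V` as a linear map. -/
def lieAction : L →ₗ[K] Module.End K V where
  toFun x := toEnd K L V x
  map_add' x y := LinearMap.ext fun v => add_lie x y v
  map_smul' c x := LinearMap.ext fun v => smul_lie c x v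

lemma finite_int_eigenspace [CharZero K] [FiniteDimensional K V] (φ : Module.End K V) :
    {m : ℤ | φ.eigenspace (2 * m : K) ≠ ⊥}.Finite := by
  refine Set.Finite.of_finite_image (f := fun m : ℤ => (2 * m : K))
    (φ.finite_hasEigenvalue.subset ?_) ?_
  · rintro _ ⟨m, hm, rfl⟩
    exact hm
  · intro a _ b _ hab
    simpa using hab

/-- If the action of a principal `sl₂` has a nonzero even eigenvalue on a finite-dimensional module
carrying an invariant alternating form, then there is a nonzero isotropic submodule. -/
lemma eigenspace_eq_bot_of_isotropic [CharZero K] [IsAlgClosed K] [FiniteDimensional K V]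
    {h e f : L} (t : IsSl2Triple h e f) (H : LieSubalgebra K L) [IsLieAbelian H]
    (hH : ∀ x, x ∈ H ↔ ⁅h, x⁆ = 0)
    (hspan : ⨆ k : ℤ, (ad K L h).eigenspace (2 * k : K) = ⊤)
    {Z : Type*} [AddCommGroup Z] [Module K Z] (B : V →ₗ[K] V →ₗ[K] Z)
    (hB : ∀ (x : L) (v w : V), B ⁅x, v⁆ w + B v ⁅x, w⁆ = 0) (hBalt : ∀ v, B v v = 0)
    (hiso : ∀ W : LieSubmodule K L V, (∀ x ∈ W, ∀ y ∈ W, B x y = 0) → W = ⊥) (k : ℤ) :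
    (toEnd K L V h).eigenspace (2 * k : K) = ⊥ := by
  by_contra hk
  set E : K → Submodule K V := fun c => (toEnd K L V h).eigenspace c with hE
  have hmem {c : K} {v : V} : v ∈ E c ↔ ⁅h, v⁆ = c • v := mem_eigenspace_iff
  have hadm {c : K} {v : L} : v ∈ (ad K L h).eigenspace c ↔ ⁅h, v⁆ = c • v := mem_eigenspace_iff
  have hfin : {m : ℤ | E (2 * m : K) ≠ ⊥}.Finite := finite_int_eigenspace _
  obtain ⟨m, hm, hmax⟩ := Set.exists_max_image _ id hfin ⟨k, hk⟩
  have hgt (q : ℤ) (hq : m < q) : E (2 * q : K) = ⊥ := by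
    by_contra hne
    exact absurd (hmax q hne) (not_le.mpr hq)
  have hact {x : L} {v : V} {a b : K} (hx : x ∈ (ad K L h).eigenspace a) (hv : v ∈ E b) :
      ⁅x, v⁆ ∈ E (a + b) := hmem.mpr (lie_mem_eigenspace (hadm.mp hx) (hmem.mp hv))
  obtain ⟨u, huE, hu0, huH⟩ := exists_common_eigenvector H (E (2 * m : K)) hm fun x hx v hv => by
    have := hact (a := 0) (hadm.mpr (by rw [zero_smul]; exact (hH x).mp hx)) hv
    rwa [zero_add] at this
  have hpos (j : ℕ) (x : L) (hx : x ∈ (ad K L h).eigenspace (2 * ((j + 1 : ℕ) : ℤ) : K)) :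
      ⁅x, u⁆ = 0 := by
    have h1 := hact hx huE
    have h2 : (2 * (((j + 1 : ℕ) : ℤ) : K) + 2 * (m : K)) = (2 * ((j + 1 + m : ℤ) : K)) := by
      push_cast; ring
    rw [h2, hgt _ (by omega)] at h1
    simpa using h1
  have hemem : e ∈ (ad K L h).eigenspace (2 * ((0 + 1 : ℕ) : ℤ) : K) :=
    hadm.mpr (by rw [t.lie_h_e_smul K]; norm_num)
  have P : t.HasPrimitiveVectorWith u (2 * m : K) := ⟨hu0, hmem.mp huE, hpos 0 e hemem⟩
  obtain ⟨p, rfl⟩ : ∃ p : ℕ, m = p := by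
    obtain ⟨n, hn⟩ := P.exists_nat
    have : (2 * m : ℤ) = n := by exact_mod_cast hn
    exact ⟨m.toNat, by omega⟩
  have hlt (q : ℤ) (hq : q < -p) : E (2 * q : K) = ⊥ := by
    by_contra hne
    obtain ⟨r, hr, hmin⟩ := Set.exists_min_image _ id hfin ⟨q, hne⟩
    obtain ⟨w, hw, hw0⟩ := Submodule.exists_mem_ne_zero_of_ne_bot hr
    have hrq : r ≤ q := hmin q hne
    have hfw : ⁅f, w⁆ = 0 := by
      have h1 : ⁅f, w⁆ ∈ E (-2 + 2 * (r : K)) :=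
        hact (hadm.mpr (by rw [t.lie_lie_smul_f K, neg_smul])) hw
      have h2 : (-2 + 2 * (r : K)) = 2 * ((r - 1 : ℤ) : K) := by push_cast; ring
      rw [h2] at h1
      by_contra h0
      have := hmin (r - 1) (Submodule.ne_bot_iff _ |>.mpr ⟨_, h1, h0⟩)
      simp at this
    have hn : ((-2 * r).toNat : K) = - (2 * (r : K)) := by
      have : (((-2 * r).toNat : ℤ) : K) = ((-2 * r : ℤ) : K) := by
        rw [Int.toNat_of_nonneg (by omega)]
      push_cast at this
      rw [this]; ring
    have Q : t.symm.HasPrimitiveVectorWith w ((-2 * r).toNat : K) :=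
      ⟨hw0, by rw [neg_lie, hmem.mp hw, hn, neg_smul], hfw⟩
    refine Q.pow_toEnd_f_ne_zero_of_eq_nat rfl (i := (-2 * r).toNat) le_rfl ?_
    have h3 := Q.lie_h_pow_toEnd_f (-2 * r).toNat
    have h4 : ((toEnd K L V e) ^ (-2 * r).toNat) w ∈ E (2 * ((-r : ℤ) : K)) := by
      rw [hmem]
      rw [neg_lie, neg_eq_iff_eq_neg, hn] at h3
      rw [h3, ← neg_smul]
      congr 1
      push_cast
      ring
    rw [hgt _ (by omega)] at h4
    simpa using h4
  set 𝔫 : Submodule K L := ⨆ k : ℕ, (ad K L h).eigenspace (-(2 * (k + 1)) : K) with h𝔫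
  set 𝔟 : Submodule K L := ⨆ k : ℕ, (ad K L h).eigenspace (2 * k : K) with h𝔟
  set Y : Submodule K V := ⨆ k : ℕ, E (2 * p - 2 * (k + 1)) with hY
  have htop : 𝔫 ⊔ 𝔟 = ⊤ := by
    rw [eq_top_iff, ← hspan]
    refine iSup_le fun k => ?_
    obtain ⟨n, rfl | rfl⟩ := k.eq_nat_or_neg
    · refine le_trans ?_ le_sup_right
      refine le_trans ?_ (le_iSup _ n)
      simp
    · rcases n with _ | n
      · refine le_trans ?_ le_sup_right
        refine le_trans ?_ (le_iSup _ 0)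
        simp
      · refine le_trans ?_ le_sup_left
        refine le_trans (le_of_eq ?_) (le_iSup _ n)
        congr 1
        push_cast
        ring
  have hbu : ∀ y ∈ 𝔟, ∃ c : K, lieAction K L V y u = c • u := by
    intro y hy
    induction hy using Submodule.iSup_induction' with
    | mem k y hy =>
      rcases k with _ | k
      · exact huH y ((hH y).mpr (by simpa using hadm.mp hy))
      · exact ⟨0, by rw [zero_smul]; exact hpos k y (by simpa using hy)⟩
    | zero => exact ⟨0, by simp⟩
    | add y z _ _ hy hz =>
      obtain ⟨a, ha⟩ := hy
      obtain ⟨b, hb⟩ := hz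
      exact ⟨a + b, by rw [map_add, LinearMap.add_apply, ha, hb, add_smul]⟩
  have huE' : u ∈ E (2 * p) := by simpa using huE
  have hnY (w : V) (hw : w ∈ Submodule.span K {u} ⊔ Y) (y : L) (hy : y ∈ 𝔫) : ⁅y, w⁆ ∈ Y := by
    induction hy using Submodule.iSup_induction' with
    | mem k y hy =>
      obtain ⟨a, ha, w, hw', rfl⟩ := Submodule.mem_sup.mp hw
      obtain ⟨c, rfl⟩ := Submodule.mem_span_singleton.mp ha
      rw [lie_add, lie_smul]
      refine Y.add_mem (Y.smul_mem _ ?_) ?_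
      · refine Submodule.mem_iSup_of_mem k ?_
        convert hact hy huE' using 2
        ring
      · clear hw ha
        induction hw' using Submodule.iSup_induction' with
        | mem j w hw =>
          refine Submodule.mem_iSup_of_mem (k + j + 1) ?_
          convert hact hy hw using 2
          push_cast
          ring
        | zero => simp
        | add v w _ _ hv hw => rw [lie_add]; exact Y.add_mem hv hw
    | zero => simp
    | add y z _ _ hy hz => rw [add_lie]; exact Y.add_mem hy hz
  obtain ⟨X, huX, hXW, hX⟩ := exists_stable_submodule (lieAction K L V)
    (fun x y v => lie_lie x y v) 𝔫 𝔟 htop u hbu (Submodule.span K {u} ⊔ Y)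
    (Submodule.mem_sup_left (Submodule.mem_span_singleton_self u))
    (fun y hy w hw => Submodule.mem_sup_right (hnY w hw y hy))
  have hX' (y : L) {x : V} (hx : x ∈ X) : ⁅y, x⁆ ∈ X := hX y x hx
  have hYdis : Disjoint (E (2 * p)) Y := by
    refine ((toEnd K L V h).eigenspaces_iSupIndep (2 * p : K)).mono_right ?_
    refine iSup_le fun k => ?_
    refine le_iSup₂_of_le (2 * p - 2 * (k + 1) : K) ?_ le_rfl
    intro hc
    have : (2 * ((k : K) + 1)) = 0 := by linear_combination -hc
    have h2 : (2 * (k + 1) : ℕ) = 0 := by exact_mod_cast this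
    omega
  have hXu (x : V) (hx : x ∈ X) (hxE : x ∈ E (2 * p)) : ∃ c : K, x = c • u := by
    obtain ⟨a, ha, y, hy, rfl⟩ := Submodule.mem_sup.mp (hXW hx)
    obtain ⟨c, rfl⟩ := Submodule.mem_span_singleton.mp ha
    have : y = 0 := Submodule.disjoint_def.mp hYdis y
      (by simpa using Submodule.sub_mem _ hxE (Submodule.smul_mem _ c huE')) hy
    exact ⟨c, by rw [this, add_zero]⟩
  have hBE {a b : K} (hab : a + b ≠ 0) {v w : V} (hv : v ∈ E a) (hw : w ∈ E b) : B v w = 0 := by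
    have h1 := hB h v w
    rw [hmem.mp hv, hmem.mp hw, map_smul, LinearMap.smul_apply, map_smul, ← add_smul] at h1
    exact (smul_eq_zero.mp h1).resolve_left hab
  have hBskew (v w : V) : B v w + B w v = 0 := by
    have := hBalt (v + w)
    simpa [hBalt] using this
  have hBf : B u (((toEnd K L V f) ^ (2 * p)) u) = 0 := by
    have h1 := bilin_pow_toEnd B hB f (2 * p) u u
    have h2 := hBskew u (((toEnd K L V f) ^ (2 * p)) u)
    rw [Even.neg_one_pow (even_two_mul p), one_smul] at h1
    rw [← h1, ← two_smul K] at h2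
    exact (smul_eq_zero.mp h2).resolve_left two_ne_zero
  have hBu (x : V) (hx : x ∈ X) : B u x = 0 := by
    have hXE : X ≤ ⨆ c, E c := by
      refine hXW.trans (sup_le ?_ (iSup_le fun k => le_iSup _ _))
      rw [Submodule.span_singleton_le_iff_mem]
      exact Submodule.mem_iSup_of_mem _ huE
    have hx' : x ∈ ⨆ c, X ⊓ E c := by
      rw [← Submodule.inf_iSup_genEigenspace (f := toEnd K L V h) (fun x hx => hX h x hx) 1]
      exact ⟨hx, hXE hx⟩
    induction hx' using Submodule.iSup_induction' with
    | mem c w hw =>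
      by_cases hc : (2 * p : K) + c = 0
      · have hw1 : w ∈ E (-(2 * p : K)) := by
          rw [← neg_eq_of_add_eq_zero_right hc] at hw; exact hw.2
        rcases eq_or_ne w 0 with rfl | hw0
        · simp
        have hfw : ⁅f, w⁆ = 0 := by
          have h1 : ⁅f, w⁆ ∈ E (-2 + -(2 * p : K)) :=
            hact (hadm.mpr (by rw [t.lie_lie_smul_f K, neg_smul])) hw1
          have h2 : (-2 + -(2 * p : K)) = 2 * ((-p - 1 : ℤ) : K) := by push_cast; ring
          rw [h2, hlt _ (by omega)] at h1
          simpa using h1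
        have Q : t.symm.HasPrimitiveVectorWith w ((2 * p : ℕ) : K) :=
          ⟨hw0, by rw [neg_lie, hmem.mp hw1]; push_cast; rw [neg_smul, neg_neg], hfw⟩
        obtain ⟨C, hC, hCw⟩ := toEnd_pow_symm_apply t Q (2 * p) le_rfl
        have hpowX (j : ℕ) : ((toEnd K L V e) ^ j) w ∈ X := by
          induction j with
          | zero => exact hw.1
          | succ j ih => rw [pow_succ', Module.End.mul_apply]; exact hX e _ ih
        obtain ⟨c', hc'⟩ := hXu _ (hpowX (2 * p)) (by
          have h3 := Q.lie_h_pow_toEnd_f (2 * p)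
          rw [neg_lie, neg_eq_iff_eq_neg, ← neg_smul] at h3
          rw [hmem, h3]
          congr 1
          push_cast
          ring)
        rw [hc', map_smul] at hCw
        have : C • B u w = 0 := by rw [← map_smul, ← hCw, map_smul, hBf, smul_zero]
        exact (smul_eq_zero.mp this).resolve_left hC
      · exact hBE hc huE' hw.2
    | zero => simp
    | add v w hv hw h1 h2 =>
      have hsub : (⨆ c, X ⊓ E c) ≤ X := iSup_le fun c => inf_le_left
      rw [map_add, h1 (hsub hv), h2 (hsub hw), add_zero]
  let X₀ : LieSubmodule K L V :=
    { carrier := {y | y ∈ X ∧ ∀ x ∈ X, B y x = 0}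
      add_mem' := fun {a b} ha hb => ⟨X.add_mem ha.1 hb.1, fun x hx => by
        rw [map_add, LinearMap.add_apply, ha.2 x hx, hb.2 x hx, add_zero]⟩
      zero_mem' := ⟨X.zero_mem, by simp⟩
      smul_mem' := fun c a ha => ⟨X.smul_mem c ha.1, fun x hx => by
        rw [map_smul, LinearMap.smul_apply, ha.2 x hx, smul_zero]⟩
      lie_mem := fun {s a} ha => ⟨hX' s ha.1, fun x hx => by
        have := hB s a x
        rwa [ha.2 _ (hX' s hx), add_zero] at this⟩ }
  have hX₀ : X₀ = ⊥ := hiso X₀ fun x hx y hy => hx.2 y hy.1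
  have : u ∈ X₀ := ⟨huX, hBu⟩
  rw [hX₀] at this
  exact hu0 (by simpa using this)

end Principal

section Killing

open LieAlgebra LieAlgebra.IsKilling LieModule Module.End

variable {K : Type*} [Field K] [CharZero K] [IsAlgClosed K]
  {L : Type*} [LieRing L] [LieAlgebra K L] [FiniteDimensional K L] [IsKilling K L]
  (H : LieSubalgebra K L) [H.IsCartanSubalgebra]

lemma exists_height_element (b : (rootSystem H).Base) :
    ∃ (h : H) (c : b.support → K), h = ∑ i, c i • coroot (i : H.root).1 ∧
      ∀ α : H.root, α.1 h = 2 * (b.height α : K) := by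
  let φ : Module.Dual K (Module.Dual K H) := b.toWeightBasis.constr K fun _ => (2 : K)
  let h : H := (Module.evalEquiv K H).symm φ
  have hφ : ∀ x : Module.Dual K H, x h = φ x := fun x => by
    simp [h]
  have hs : ∀ i ∈ b.support, (rootSystem H).root i h = 2 := fun i hi => by
    rw [hφ, ← b.toWeightBasis_apply ⟨i, hi⟩]
    exact b.toWeightBasis.constr_basis K _ _
  refine ⟨h, fun i => b.toCoweightBasis.repr h i, ?_, fun α => ?_⟩
  · conv_lhs => rw [← b.toCoweightBasis.sum_repr h]
    simp
  · obtain ⟨f, hf1, -, hf2⟩ := b.exists_root_eq_sum_int α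
    have := b.height_eq_sum hf2
    have h3 : (rootSystem H).root α h = α.1 h := rfl
    rw [← h3, hf2, this]
    simp only [LinearMap.sum_apply, LinearMap.smul_apply]
    push_cast
    rw [Finset.mul_sum]
    exact Finset.sum_congr rfl fun i hi => by rw [hs i hi]; simp [mul_comm]

lemma lie_eq_smul_of_isNonZero {α : Weight K H L} {x : L} (hx : x ∈ rootSpace H α) (y : H) :
    ⁅(y : L), x⁆ = α y • x := lie_eq_smul_of_mem_rootSpace hx y

lemma lie_eq_zero_of_ne {b : (rootSystem H).Base} {i j : H.root} (hi : i ∈ b.support)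
    (hj : j ∈ b.support) (hij : i ≠ j) {x y : L} (hx : x ∈ rootSpace H i.1)
    (hy : y ∈ rootSpace H (-j.1 : H → K)) :
    ⁅x, y⁆ = 0 := by
  have h1 := lie_mem_genWeightSpace_of_mem_genWeightSpace hx hy
  have h2 : rootSpace H ((i.1 : H → K) + (-j.1 : H → K)) = ⊥ := by
    by_contra hne
    have hne0 : (i.1 : H → K) + (-j.1 : H → K) ≠ 0 := fun h0 => hij <| by
      have : (i.1 : H → K) = j.1 := by rwa [add_neg_eq_zero] at h0
      exact Subtype.ext (DFunLike.coe_injective this)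
    let w : Weight K H L := ⟨_, hne⟩
    have hw : w ∈ H.root := by
      rw [LieSubalgebra.root, Finset.mem_filter]
      exact ⟨Finset.mem_univ _, hne0⟩
    refine b.sub_notMem_range_root hi hj ⟨⟨w, hw⟩, ?_⟩
    ext x
    simp [w, sub_eq_add_neg]
  have h3 : ⁅x, y⁆ ∈ (⊥ : LieSubmodule K H L) := h2 ▸ h1
  simpa using h3

theorem exists_principal [Nontrivial L] :
    ∃ (h : H) (e f : L), IsSl2Triple (h : L) e f ∧
      ∀ α : Weight K H L, ∃ k : ℤ, α h = 2 * (k : K) ∧ (α.IsNonZero → k ≠ 0) := by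
  classical
  have : Nonempty (rootSystem H).Base := RootPairing.nonempty_base _
  obtain ⟨b⟩ := this
  obtain ⟨h, c, hc, hα⟩ := exists_height_element H b
  have hnz : ∀ i : H.root, i.1.IsNonZero := H.isNonZero_coe_root
  choose h' e f t he hf using fun i : H.root => exists_isSl2Triple_of_weight_isNonZero (hnz i)
  have hh' : ∀ i, h' i = coroot i.1 := fun i => (t i).h_eq_coroot (hnz i) (he i) (hf i)
  have hs : ∀ i ∈ b.support, i.1 h = 2 := fun i hi => by
    rw [hα, b.height_one_of_mem_support hi]; simp
  have hw : ∀ α : Weight K H L, ∃ k : ℤ, α h = 2 * (k : K) ∧ (α.IsNonZero → k ≠ 0) := by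
    intro α
    by_cases hz : α.IsZero
    · exact ⟨0, by simp [hz.eq], fun h => absurd hz h⟩
    · exact ⟨b.height ⟨α, by simpa using hz⟩, hα ⟨α, by simpa using hz⟩,
        fun _ => b.height_ne_zero _⟩
  have hne : Nonempty H.root := by
    by_contra hem
    rw [not_nonempty_iff] at hem
    have h0 := iSup_genWeightSpace_eq_top' K H L
    have h1 : (⨆ χ : Weight K H L, genWeightSpace L χ) ≤ rootSpace H (0 : H → K) := by
      refine iSup_le fun χ => ?_
      by_cases hz : χ.IsZero
      · rw [hz.eq]
      · exact (hem.false ⟨χ, by simpa using hz⟩).elim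
    rw [h0, rootSpace_zero_eq] at h1
    have h2 : ∀ x : L, x ∈ H := fun x => h1 (LieSubmodule.mem_top x)
    have : IsLieAbelian L := ⟨fun x y => by
      have := trivial_lie_zero H H ⟨x, h2 x⟩ ⟨y, h2 y⟩
      exact congrArg Subtype.val this⟩
    exact not_subsingleton L (subsingleton_of_hasTrivialRadical_lie_abelian K L)
  refine ⟨h, ∑ i : b.support, e i, ∑ i : b.support, c i • f i, ⟨?_, ?_, ?_, ?_⟩, hw⟩
  · obtain ⟨i⟩ := hne
    intro h0
    have := hα i
    rw [show h = 0 from Subtype.ext h0] at this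
    simp [b.height_ne_zero] at this
  · rw [_root_.sum_lie_sum, hc]
    push_cast
    refine Finset.sum_congr rfl fun i _ => ?_
    rw [Finset.sum_eq_single i]
    · rw [lie_smul, (t i).lie_e_f, hh']
    · intro j _ hj
      rw [lie_smul, lie_eq_zero_of_ne H i.2 j.2 (fun h => hj (Subtype.ext h.symm)) (he i) (hf j),
        smul_zero]
    · simp
  · rw [lie_sum, Finset.smul_sum]
    refine Finset.sum_congr rfl fun i _ => ?_
    rw [lie_eq_smul_of_isNonZero H (he i), hs i i.2, ofNat_smul_eq_nsmul]
  · rw [lie_sum, Finset.smul_sum, ← Finset.sum_neg_distrib]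
    refine Finset.sum_congr rfl fun i _ => ?_
    rw [lie_smul, ← H.coe_bracket_of_module, lie_eq_smul_of_mem_rootSpace (hf i)]
    simp only [Pi.neg_apply]
    rw [hs i i.2, neg_smul, ofNat_smul_eq_nsmul, smul_neg, smul_comm]

variable {Z V : Type*} [AddCommGroup Z] [Module K Z] [AddCommGroup V] [Module K V]
  [LieRingModule L V] [LieModule K L V] [FiniteDimensional K V]

theorem eq_zero_of_isotropic_of_weight (B : V →ₗ[K] V →ₗ[K] Z)
    (hB : ∀ (x : L) v w, B ⁅x, v⁆ w + B v ⁅x, w⁆ = 0) (hBalt : ∀ v, B v v = 0)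
    (hiso : ∀ W : LieSubmodule K L V, (∀ x ∈ W, ∀ y ∈ W, B x y = 0) → W = ⊥)
    (α : H → K) (hα : α = 0 ∨ rootSpace H α ≠ ⊥)
    {v : V} (hv : ∀ x : H, ⁅(x : L), v⁆ = α x • v) : v = 0 := by
  rcases subsingleton_or_nontrivial L with hL | hL
  · let W : LieSubmodule K L V := { K ∙ v with
      lie_mem := fun {x m} _ => by
        rw [Subsingleton.elim x 0, zero_lie]; exact Submodule.zero_mem _ }
    have : W = ⊥ := hiso W fun x hx y hy => by
      obtain ⟨a, rfl⟩ := Submodule.mem_span_singleton.1 hx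
      obtain ⟨b, rfl⟩ := Submodule.mem_span_singleton.1 hy
      simp [hBalt]
    have hm : v ∈ W := Submodule.mem_span_singleton_self v
    rw [this] at hm
    simpa using hm
  · obtain ⟨h, e, f, t, hw⟩ := exists_principal H
    have hroot : ∀ (β : Weight K H L) (y) (_ : y ∈ rootSpace H β), ⁅(h : L), y⁆ = β h • y :=
      fun β y hy => lie_eq_smul_of_isNonZero H hy h
    have hspan : ⨆ k : ℤ, (ad K L h).eigenspace (2 * k : K) = ⊤ := by
      rw [eq_top_iff, ← LieSubmodule.top_toSubmodule (R := K) (L := H),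
        ← iSup_genWeightSpace_eq_top' K H L, LieSubmodule.iSup_toSubmodule]
      refine iSup_le fun β => ?_
      obtain ⟨k, hk, -⟩ := hw β
      refine le_trans (fun y hy => ?_) (le_iSup _ k)
      rw [mem_eigenspace_iff, ad_apply, ← hk]
      exact hroot β y hy
    have hH : ∀ x, x ∈ H ↔ ⁅(h : L), x⁆ = 0 := by
      intro x
      refine ⟨fun hx => congrArg Subtype.val (trivial_lie_zero H H h ⟨x, hx⟩), fun hx => ?_⟩
      have h0 : ∀ y ∈ H, ⁅(h : L), y⁆ = 0 := fun y hy =>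
        congrArg Subtype.val (trivial_lie_zero H H h ⟨y, hy⟩)
      have hle : (⊤ : Submodule K L) ≤
          H.toSubmodule ⊔ ⨆ μ ≠ (0 : K), (ad K L h).eigenspace μ := by
        rw [← LieSubmodule.top_toSubmodule (R := K) (L := H),
          ← iSup_genWeightSpace_eq_top' K H L, LieSubmodule.iSup_toSubmodule]
        refine iSup_le fun β => ?_
        by_cases hz : β.IsZero
        · refine le_trans ?_ le_sup_left
          rw [hz.eq]
          exact le_of_eq (congrArg LieSubmodule.toSubmodule (rootSpace_zero_eq K L H))
        · obtain ⟨k, hk, hk0⟩ := hw β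
          refine le_trans (fun y hy => ?_) (le_sup_of_le_right
            (le_iSup₂ (f := fun μ (_ : μ ≠ (0 : K)) => (ad K L h).eigenspace μ) (β h) ?_))
          · rw [mem_eigenspace_iff, ad_apply]
            exact hroot β y hy
          · rw [hk]
            exact mul_ne_zero two_ne_zero (Int.cast_ne_zero.2 (hk0 hz))
      obtain ⟨y, hy, z, hz, rfl⟩ := Submodule.mem_sup.1 (hle (Submodule.mem_top (x := x)))
      have hz0 : z ∈ (ad K L h).eigenspace 0 := by
        rw [mem_eigenspace_iff, ad_apply, zero_smul]
        simpa [h0 y hy] using hx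
      have := (Submodule.disjoint_def.1 ((eigenspaces_iSupIndep (ad K L h)) 0)) z hz0 hz
      rw [this, add_zero]
      exact hy
    have key := eigenspace_eq_bot_of_isotropic t H hH hspan B hB hBalt hiso
    obtain ⟨k, hk⟩ : ∃ k : ℤ, α h = 2 * (k : K) := by
      rcases hα with rfl | hα
      · exact ⟨0, by simp⟩
      · obtain ⟨k, hk, -⟩ := hw ⟨α, hα⟩
        exact ⟨k, hk⟩
    have hm : v ∈ (toEnd K L V h).eigenspace (2 * k : K) := by
      rw [mem_eigenspace_iff, toEnd_apply_apply, ← hk, hv]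
    rw [key] at hm
    simpa using hm

end Killing

section Quotient

open LieAlgebra LieModule Module.End

variable {K : Type*} [Field K] {L : Type*} [LieRing L] [LieAlgebra K L]
variable (I : LieIdeal K L) {V : Type*} [AddCommGroup V] [Module K V] [LieRingModule L V]
  [LieModule K L V]

/-- The projection of a Lie algebra onto its quotient by an ideal. -/
def mkHom : L →ₗ⁅K⁆ L ⧸ I :=
  { I.toSubmodule.mkQ with map_lie' := fun {_ _} => rfl }

lemma mkHom_eq_zero {x : L} : mkHom I x = 0 ↔ x ∈ I := Submodule.Quotient.mk_eq_zero _

lemma mkHom_surjective : Function.Surjective (mkHom I) := Submodule.mkQ_surjective _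

lemma lie_eq_mkHom_lie (x : L) (s : L ⧸ I) : ⁅x, s⁆ = ⁅mkHom I x, s⁆ := by
  obtain ⟨y, rfl⟩ := mkHom_surjective I s
  rfl

/-- The action of a quotient Lie algebra on a module killed by the ideal. -/
@[reducible]
def quotLieRingModule (hI : ∀ x ∈ I, ∀ v : V, ⁅x, v⁆ = 0) : LieRingModule (L ⧸ I) V :=
  let φ : L ⧸ I →ₗ[K] Module.End K V := I.toSubmodule.liftQ (lieAction K L V)
    fun x hx => LinearMap.ext fun v => hI x hx v
  { bracket := fun s v => φ s v
    add_lie := fun s t v => by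
      change φ (s + t) v = φ s v + φ t v
      rw [map_add]; rfl
    lie_add := fun s v w => map_add _ _ _
    leibniz_lie := fun s t v => by
      obtain ⟨x, rfl⟩ := mkHom_surjective I s
      obtain ⟨y, rfl⟩ := mkHom_surjective I t
      exact leibniz_lie x y v }

lemma quotLieModule (hI : ∀ x ∈ I, ∀ v : V, ⁅x, v⁆ = 0) :
    letI := quotLieRingModule I hI
    LieModule K (L ⧸ I) V := by
  let _ := quotLieRingModule I hI
  refine ⟨fun c s v => ?_, fun c s v => ?_⟩
  · obtain ⟨x, rfl⟩ := mkHom_surjective I s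
    exact smul_lie c x v
  · obtain ⟨x, rfl⟩ := mkHom_surjective I s
    exact lie_smul c x v

end Quotient

section Cartan

open LieAlgebra LieModule Module.End

variable {K : Type*} [Field K] [IsAlgClosed K] {L : Type*} [LieRing L]
  [LieAlgebra K L] [FiniteDimensional K L] (I : LieIdeal K L)
  (H : LieSubalgebra K L) [H.IsCartanSubalgebra]

lemma exists_cartan_add (y : L) :
    ∃ u ∈ H, ∃ z ∈ ⨆ χ ≠ (0 : H → K), (rootSpace H χ).toSubmodule, y = u + z := by
  have hle : (⊤ : Submodule K L) ≤
      H.toSubmodule ⊔ ⨆ χ ≠ (0 : H → K), (rootSpace H χ).toSubmodule := by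
    rw [← LieSubmodule.top_toSubmodule (R := K) (L := H),
      ← iSup_genWeightSpace_eq_top K H L, LieSubmodule.iSup_toSubmodule]
    refine iSup_le fun χ => ?_
    by_cases hz : χ = 0
    · refine le_trans ?_ le_sup_left
      rw [hz]
      exact le_of_eq (congrArg LieSubmodule.toSubmodule (rootSpace_zero_eq K L H))
    · exact le_sup_of_le_right
        (le_iSup₂ (f := fun χ (_ : χ ≠ (0 : H → K)) => (rootSpace H χ).toSubmodule) χ hz)
  obtain ⟨y, hy, z, hz, h⟩ := Submodule.mem_sup.1 (hle (Submodule.mem_top (x := y)))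
  exact ⟨y, hy, z, hz, h.symm⟩

instance isCartanSubalgebra_map_mkHom : (H.map (mkHom I)).IsCartanSubalgebra := by
  let H' := H.map (mkHom I)
  let π : H →ₗ⁅K⁆ H' :=
    { toFun := fun x => ⟨mkHom I x, x, x.2, rfl⟩
      map_add' := fun x y => rfl
      map_smul' := fun c x => rfl
      map_lie' := fun {x y} => rfl }
  have hπ : Function.Surjective π := by
    rintro ⟨_, x, hx, rfl⟩
    exact ⟨⟨x, hx⟩, rfl⟩
  have : LieRing.IsNilpotent H' := hπ.lieAlgebra_isNilpotent
  rw [← eq_rootSpace_zero_iff_isCartan]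
  refine le_antisymm (toLieSubmodule_le_rootSpace_zero K (L ⧸ I) H') fun s hs => ?_
  have hs' : s ∈ genWeightSpace (L ⧸ I) (0 : H → K) := by
    rw [mem_genWeightSpace] at hs ⊢
    intro x
    obtain ⟨k, hk⟩ := hs (π x)
    refine ⟨k, ?_⟩
    have : toEnd K H (L ⧸ I) x = toEnd K H' (L ⧸ I) (π x) :=
      LinearMap.ext fun t => lie_eq_mkHom_lie I (x : L) t
    rw [this]
    exact hk
  obtain ⟨y, rfl⟩ := mkHom_surjective I s
  obtain ⟨u, hu, z, hz, rfl⟩ := exists_cartan_add H y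
  let f : L →ₗ⁅K, H⁆ L ⧸ I := { mkHom I with map_lie' := fun {_ _} => rfl }
  have hz' : f z ∈ ⨆ χ ≠ (0 : H → K), genWeightSpace (L ⧸ I) χ := by
    have : (⨆ χ ≠ (0 : H → K), (rootSpace H χ)).map f ≤
        ⨆ χ ≠ (0 : H → K), genWeightSpace (L ⧸ I) χ := by
      simp only [LieSubmodule.map_iSup]
      exact iSup₂_mono fun χ _ => map_genWeightSpace_le f
    refine this ⟨z, ?_, rfl⟩
    simpa only [SetLike.mem_coe, ← LieSubmodule.mem_toSubmodule,
      LieSubmodule.iSup_toSubmodule] using hz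
  have hu' : f u ∈ genWeightSpace (L ⧸ I) (0 : H → K) := by
    refine map_genWeightSpace_le f ⟨u, ?_, rfl⟩
    have : u ∈ H.toLieSubmodule := hu
    rw [← rootSpace_zero_eq K L H] at this
    exact this
  have hfz : f z ∈ genWeightSpace (L ⧸ I) (0 : H → K) := by
    have : f z = f (u + z) - f u := by rw [map_add, add_sub_cancel_left]
    rw [this]
    exact sub_mem hs' hu'
  have h0 : f z = 0 := by
    have := (iSupIndep_genWeightSpace K H (L ⧸ I) 0).le_bot ⟨hfz, hz'⟩
    simpa using this
  have : mkHom I (u + z) = mkHom I u := by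
    rw [map_add, show mkHom I z = 0 from h0, add_zero]
  rw [this]
  exact ⟨u, hu, rfl⟩

end Cartan

section Radical

open LieAlgebra LieModule Module.End

variable {K : Type*} [Field K] {L : Type*} [LieRing L] [LieAlgebra K L] [FiniteDimensional K L]

instance hasTrivialRadical_quotient : HasTrivialRadical K (L ⧸ radical K L) := by
  rw [hasTrivialRadical_iff_no_abelian_ideals]
  intro J hJ
  let J' : LieIdeal K L := J.comap (mkHom (radical K L))
  have h1 : derivedSeriesOfIdeal K L 1 J' ≤ radical K L := by
    rw [derivedSeriesOfIdeal_succ, derivedSeriesOfIdeal_zero, LieSubmodule.lieIdeal_oper_eq_span,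
      LieSubmodule.lieSpan_le]
    rintro _ ⟨x, y, rfl⟩
    rw [SetLike.mem_coe, ← mkHom_eq_zero, LieHom.map_lie]
    have := trivial_lie_zero J J ⟨_, x.2⟩ ⟨_, y.2⟩
    exact congrArg Subtype.val this
  obtain ⟨k, hk⟩ := (isSolvable_iff K (radical K L)).1 inferInstance
  have hk' : derivedSeriesOfIdeal K L k (radical K L) = ⊥ :=
    (LieIdeal.derivedSeries_eq_bot_iff _ _).1 hk
  have h2 : derivedSeriesOfIdeal K L (k + 1) J' = ⊥ := by
    rw [derivedSeriesOfIdeal_add]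
    exact le_bot_iff.1 ((derivedSeriesOfIdeal_mono h1 k).trans hk'.le)
  have h3 : IsSolvable J' :=
    (isSolvable_iff K J').2 ⟨k + 1, (LieIdeal.derivedSeries_eq_bot_iff _ _).2 h2⟩
  have h4 : J' ≤ radical K L := (LieIdeal.solvable_iff_le_radical K L J').1 h3
  rw [LieSubmodule.eq_bot_iff]
  intro s hs
  obtain ⟨y, rfl⟩ := mkHom_surjective _ s
  exact (mkHom_eq_zero _).2 (h4 hs)

end Radical

section Reductive

open LieAlgebra LieModule Module.End

variable (K : Type*) [Field K] (L : Type*) [LieRing L] [LieAlgebra K L]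

/-- The Lie bracket, descended to the quotient by the center in both arguments. -/
def centerBracket : (L ⧸ center K L) →ₗ[K] (L ⧸ center K L) →ₗ[K] L :=
  (center K L).toSubmodule.liftQ
    { toFun := fun x => (center K L).toSubmodule.liftQ (lieAction K L L x)
        fun _ hz => lie_center_eq_zero hz x
      map_add' := fun x y => by
        refine LinearMap.ext fun z => ?_
        obtain ⟨z, rfl⟩ := mkHom_surjective _ z
        exact add_lie x y z
      map_smul' := fun c x => by
        refine LinearMap.ext fun z => ?_
        obtain ⟨z, rfl⟩ := mkHom_surjective _ z
        exact smul_lie c x z }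
    fun z hz => by
      rw [LinearMap.mem_ker]
      refine LinearMap.ext fun x => ?_
      obtain ⟨x, rfl⟩ := mkHom_surjective _ x
      exact mem_center_iff'.1 hz x

variable {K L}

variable (K L) in
/-- The image of the radical in the quotient by the center. -/
abbrev radQuot [FiniteDimensional K L] : LieSubmodule K L (L ⧸ center K L) :=
  LieSubmodule.map (LieSubmodule.Quotient.mk' (center K L)) (radical K L)

variable [FiniteDimensional K L]

/-- The class of an element of the radical. -/
def radMk (r : L) (hr : r ∈ radical K L) : radQuot K L := ⟨mkHom _ r, r, hr, rfl⟩

lemma radMk_surj (v : radQuot K L) : ∃ r hr, v = radMk (K := K) r hr := by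
  obtain ⟨_, r, hr, rfl⟩ := v
  exact ⟨r, hr, rfl⟩

lemma radMk_eq_zero {r : L} {hr : r ∈ radical K L} : radMk (K := K) r hr = 0 ↔ r ∈ center K L := by
  rw [← mkHom_eq_zero (center K L)]
  exact Subtype.ext_iff

lemma lie_radMk (x r : L) (hr : r ∈ radical K L) :
    ⁅x, radMk (K := K) r hr⁆ = radMk ⁅x, r⁆ (lie_mem_right K L _ x r hr) := rfl

variable (K L) in
/-- The bracket, as a bilinear map on `radQuot`. -/
def radBracket : radQuot K L →ₗ[K] radQuot K L →ₗ[K] L :=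
  (centerBracket K L).domRestrict₁₂ (radQuot K L).toSubmodule (radQuot K L).toSubmodule

lemma radBracket_mk (r s : L) (hr : r ∈ radical K L) (hs : s ∈ radical K L) :
    radBracket K L (radMk r hr) (radMk s hs) = ⁅r, s⁆ := rfl

lemma radBracket_self (v : radQuot K L) : radBracket K L v v = 0 := by
  obtain ⟨r, hr, rfl⟩ := radMk_surj v
  rw [radBracket_mk, lie_self]

lemma AbelianCentral.eq_bot_of_isotropic (hP : AbelianCentral K L) (W : LieSubmodule K L (radQuot K L))
    (hW : ∀ v ∈ W, ∀ w ∈ W, radBracket K L v w = 0) : W = ⊥ := by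
  let W' : LieIdeal K L :=
    { carrier := {r | ∃ hr : r ∈ radical K L, radMk r hr ∈ W}
      add_mem' := fun {a b} ⟨ha, ha'⟩ ⟨hb, hb'⟩ => ⟨add_mem ha hb, add_mem ha' hb'⟩
      zero_mem' := ⟨zero_mem _, zero_mem W⟩
      smul_mem' := fun c a ⟨ha, ha'⟩ => ⟨Submodule.smul_mem _ c ha, Submodule.smul_mem _ c ha'⟩
      lie_mem := fun {x a} ⟨ha, ha'⟩ => ⟨lie_mem_right K L _ x a ha, W.lie_mem ha'⟩ }
  have h := hP.le_center W' fun x ⟨hx, hx'⟩ y ⟨hy, hy'⟩ => hW _ hx' _ hy'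
  rw [LieSubmodule.eq_bot_iff]
  intro v hv
  obtain ⟨r, hr, rfl⟩ := radMk_surj v
  exact radMk_eq_zero.2 (h ⟨hr, hv⟩)

variable [CharZero K] [IsAlgClosed K]

lemma AbelianCentral.lie_radical_mem (hP : AbelianCentral K L) {r s : L} (hr : r ∈ radical K L) (hs : s ∈ radical K L) :
    ⁅r, s⁆ ∈ center K L :=
  hP.radical_lie_le_center (LieSubmodule.lie_mem_lie hr hs)

lemma AbelianCentral.radical_lie_radQuot (hP : AbelianCentral K L) (r : L) (hr : r ∈ radical K L) (v : radQuot K L) :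
    ⁅r, v⁆ = 0 := by
  obtain ⟨s, hs, rfl⟩ := radMk_surj v
  rw [lie_radMk, radMk_eq_zero]
  exact hP.lie_radical_mem hr hs

lemma AbelianCentral.radBracket_invariant (hP : AbelianCentral K L) (x : L) (v w : radQuot K L) :
    radBracket K L ⁅x, v⁆ w + radBracket K L v ⁅x, w⁆ = 0 := by
  obtain ⟨r, hr, rfl⟩ := radMk_surj v
  obtain ⟨s, hs, rfl⟩ := radMk_surj w
  rw [lie_radMk, lie_radMk, radBracket_mk, radBracket_mk, ← leibniz_lie]
  exact lie_center_eq_zero (hP.lie_radical_mem hr hs) x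

variable (H : LieSubalgebra K L) [H.IsCartanSubalgebra]

theorem AbelianCentral.genWeightSpace_radQuot_eq_bot (hP : AbelianCentral K L) (χ : H → K)
    (hχ : χ = 0 ∨ genWeightSpace (L ⧸ radical K L) χ ≠ ⊥) :
    genWeightSpace (radQuot K L) χ = ⊥ := by
  by_contra hne
  obtain ⟨v, hv0, hv⟩ := exists_forall_lie_eq_smul K H (radQuot K L) ⟨χ, hne⟩
  refine hv0 ?_
  let _ := quotLieRingModule (V := radQuot K L) (radical K L) hP.radical_lie_radQuot
  have := quotLieModule (V := radQuot K L) (radical K L) hP.radical_lie_radQuot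
  let H' := H.map (mkHom (radical K L))
  let σ : H' → H := fun y => ⟨y.2.choose, y.2.choose_spec.1⟩
  have hσ : ∀ y : H', mkHom (radical K L) (σ y : L) = y := fun y => y.2.choose_spec.2
  have key : ∀ (x : L) (v : radQuot K L), ⁅mkHom (radical K L) x, v⁆ = ⁅x, v⁆ := fun _ _ => rfl
  refine eq_zero_of_isotropic_of_weight H' (radBracket K L) (fun x v w => ?_)
    radBracket_self (fun W hW => ?_) (χ ∘ σ) ?_ (v := v) fun y => ?_
  · obtain ⟨x, rfl⟩ := mkHom_surjective _ x
    exact hP.radBracket_invariant x v w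
  · let W' : LieSubmodule K L (radQuot K L) :=
      { W.toSubmodule with
        lie_mem := fun {x w} hw => W.lie_mem (x := mkHom (radical K L) x) hw }
    have := hP.eq_bot_of_isotropic W' hW
    rw [LieSubmodule.eq_bot_iff] at this ⊢
    exact this
  · refine hχ.imp (fun h => by rw [h]; rfl) fun h h0 => ?_
    obtain ⟨s, hs0, hs⟩ := exists_forall_lie_eq_smul K H (L ⧸ radical K L) ⟨χ, h⟩
    refine hs0 ?_
    have : s ∈ rootSpace H' (χ ∘ σ) := by
      refine weightSpace_le_genWeightSpace _ _ ((mem_weightSpace _ _).2 fun y => ?_)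
      rw [LieSubalgebra.coe_bracket_of_module, ← hσ y, ← lie_eq_mkHom_lie]
      exact hs (σ y)
    rw [h0] at this
    simpa using this
  · rw [← hσ y, key]
    exact hv (σ y)

end Reductive

section Semisimple

variable {K : Type*} [Field K] {L : Type*} [LieRing L] [LieAlgebra K L]
  {V : Type*} [AddCommGroup V] [Module K V] [LieRingModule L V] [LieModule K L V]
  {Z : Type*} [AddCommGroup Z] [Module K Z]

lemma lie_mem_of_span_eq_top {s : Set L} (hs : Submodule.span K s = ⊤) {W : Submodule K V}
    (hW : ∀ y ∈ s, ∀ v ∈ W, ⁅y, v⁆ ∈ W) (y : L) {v : V} (hv : v ∈ W) : ⁅y, v⁆ ∈ W := by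
  have hy : y ∈ Submodule.span K s := hs ▸ Submodule.mem_top
  induction hy using Submodule.span_induction with
  | mem y hy => exact hW y hy v hv
  | zero => rw [zero_lie]; exact zero_mem W
  | add a b _ _ ha hb => rw [add_lie]; exact add_mem ha hb
  | smul c a _ ha => rw [smul_lie]; exact W.smul_mem c ha

theorem lie_eq_smul_of_isotropic [IsAlgClosed K] [FiniteDimensional K V]
    (B : V →ₗ[K] V →ₗ[K] Z) (hB : ∀ (x : L) v w, B ⁅x, v⁆ w + B v ⁅x, w⁆ = 0)
    (hiso : ∀ W : LieSubmodule K L V, (∀ x ∈ W, ∀ y ∈ W, B x y = 0) → W = ⊥)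
    {s : Set L} (hs : Submodule.span K s = ⊤) (x : L)
    (hx : ∀ y ∈ s, ∃ a : K, ∀ v : V, ⁅y, ⁅x, v⁆⁆ = ⁅x, ⁅y, v⁆⁆ - a • ⁅y, v⁆)
    (c : K) (k : ℕ) (v : V) (hv : ((LieModule.toEnd K L V x - c • 1) ^ k) v = 0) :
    ⁅x, v⁆ = c • v := by
  set T := LieModule.toEnd K L V x with hT
  have hTx : ∀ v, T v = ⁅x, v⁆ := fun v => rfl
  let E : LieSubmodule K L V :=
    { (⨆ d : K, T.eigenspace d) with
      lie_mem := fun {y w} hw => by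
        refine lie_mem_of_span_eq_top hs (fun y hy v hv => ?_) y hw
        obtain ⟨a, ha⟩ := hx y hy
        induction hv using Submodule.iSup_induction' with
        | mem d v hv =>
          refine Submodule.mem_iSup_of_mem (d + a) (Module.End.mem_eigenspace_iff.2 ?_)
          have h1 := ha v
          rw [← hTx v, Module.End.mem_eigenspace_iff.1 hv, lie_smul] at h1
          rw [hTx, add_smul, h1]
          abel
        | zero => rw [lie_zero]; exact zero_mem _
        | add u w _ _ hu hw => rw [lie_add]; exact add_mem hu hw }
  have hE : ∀ (d : K) (v : V), T v = d • v → v ∈ E := fun d v h =>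
    Submodule.mem_iSup_of_mem (p := fun d => T.eigenspace d) d (Module.End.mem_eigenspace_iff.2 h)
  let P : LieSubmodule K L V :=
    { carrier := {v | ∀ w ∈ E, B v w = 0}
      add_mem' := fun {a b} ha hb w hw => by
        rw [map_add, LinearMap.add_apply, ha w hw, hb w hw, add_zero]
      zero_mem' := fun w _ => by rw [map_zero, LinearMap.zero_apply]
      smul_mem' := fun c a ha w hw => by
        rw [map_smul, LinearMap.smul_apply, ha w hw, smul_zero]
      lie_mem := fun {y v} hv w hw => by
        have h := hB y v w
        rwa [hv _ (E.lie_mem hw), add_zero] at h }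
  have hP : P = ⊥ := by
    have hEP : E ⊓ P = ⊥ := hiso _ fun a ha b hb => ha.2 b hb.1
    by_contra hne
    have hPT : ∀ v ∈ P.toSubmodule, T v ∈ P.toSubmodule := fun v hv => P.lie_mem hv
    have : Nontrivial P.toSubmodule :=
      (Submodule.nontrivial_iff_ne_bot).2 fun h => hne (by simpa using h)
    obtain ⟨d, hd⟩ := Module.End.exists_eigenvalue (T.restrict hPT)
    obtain ⟨⟨u, huP⟩, hu, hu0⟩ := hd.exists_hasEigenvector
    have hud : T u = d • u := congrArg Subtype.val (Module.End.mem_eigenspace_iff.1 hu)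
    have : u ∈ E ⊓ P := ⟨hE d u hud, huP⟩
    rw [hEP] at this
    exact hu0 (Subtype.ext (by simpa using this))
  have hinv : ∀ (v : V) (d : K) (w : V), T w = d • w → B ((T - c • 1) v) w = -(c + d) • B v w := by
    intro v d w hw
    have h := hB x v w
    rw [← hTx, ← hTx, hw, map_smul] at h
    rw [LinearMap.sub_apply, map_sub, LinearMap.sub_apply, eq_neg_of_add_eq_zero_left h]
    simp only [LinearMap.smul_apply, Module.End.one_apply, map_smul]
    module
  have horth : ∀ (d : K) (w : V), T w = d • w → B ((T - c • 1) v) w = 0 := by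
    intro d w hw
    rw [hinv v d w hw]
    by_cases hcd : c + d = 0
    · rw [hcd, neg_zero, zero_smul]
    have hpow : ∀ n, B (((T - c • 1) ^ n) v) w = (-(c + d)) ^ n • B v w := by
      intro n
      induction n with
      | zero => simp
      | succ n ih => rw [pow_succ', Module.End.mul_apply, hinv _ d w hw, ih, smul_smul, pow_succ']
    have h := hpow k
    rw [hv, map_zero, LinearMap.zero_apply, eq_comm,
      smul_eq_zero_iff_right (pow_ne_zero k (neg_ne_zero.2 hcd))] at h
    rw [h, smul_zero]
  have hmem : (T - c • 1) v ∈ P := by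
    intro w hw
    change w ∈ ⨆ d : K, T.eigenspace d at hw
    induction hw using Submodule.iSup_induction' with
    | mem d w hw => exact horth d w (Module.End.mem_eigenspace_iff.1 hw)
    | zero => rw [map_zero]
    | add a b _ _ ha hb => rw [map_add, ha, hb, add_zero]
  rw [hP, LieSubmodule.mem_bot, LinearMap.sub_apply, sub_eq_zero] at hmem
  exact hmem

end Semisimple

section Cartan

open LieAlgebra LieModule

lemma lie_top_eq_top_of_isKilling {K S : Type*} [Field K] [LieRing S] [LieAlgebra K S]
    [FiniteDimensional K S] [CharZero K] [IsKilling K S] :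
    ⁅(⊤ : LieIdeal K S), (⊤ : LieIdeal K S)⁆ = ⊤ := by
  obtain ⟨C, hC⟩ := exists_isCompl ⁅(⊤ : LieIdeal K S), (⊤ : LieIdeal K S)⁆
  have hC' : C = ⊥ := by
    have : IsLieAbelian C := by
      refine ⟨fun x y => ?_⟩
      have h : ⁅(x : S), (y : S)⁆ ∈ ⁅(⊤ : LieIdeal K S), (⊤ : LieIdeal K S)⁆ ⊓ C :=
        ⟨LieSubmodule.lie_mem_lie (LieSubmodule.mem_top _) (LieSubmodule.mem_top _),
          lie_mem_right K S C x y y.2⟩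
      rw [hC.inf_eq_bot, LieSubmodule.mem_bot] at h
      exact Subtype.ext h
    exact HasTrivialRadical.eq_bot_of_isSolvable C
  have := hC.sup_eq_top
  rwa [hC', sup_bot_eq] at this

variable {K : Type*} [Field K] {L : Type*} [LieRing L] [LieAlgebra K L]
  (H : LieSubalgebra K L) [H.IsCartanSubalgebra]

/-- The projection onto a quotient as a map of modules over a subalgebra. -/
def mkRes (I : LieIdeal K L) : L →ₗ⁅K,H⁆ (L ⧸ I) :=
  { (mkHom I : L →ₗ[K] L ⧸ I) with map_lie' := fun {_ _} => rfl }

lemma mkHom_mem_genWeightSpace (I : LieIdeal K L) {α : H → K} {y : L} (hy : y ∈ rootSpace H α) :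
    mkHom I y ∈ genWeightSpace (L ⧸ I) α :=
  map_genWeightSpace_le (mkRes H I) (LieSubmodule.mem_map_of_mem hy)

lemma center_le_rootSpace_zero {z : L} (hz : z ∈ center K L) : z ∈ rootSpace H (0 : H → K) := by
  refine weightSpace_le_genWeightSpace _ _ ((mem_weightSpace _ _).2 fun x => ?_)
  rw [Pi.zero_apply, zero_smul]
  exact lie_center_eq_zero hz x

lemma lie_mem_rootSpace {α : H → K} {y : L} (hy : y ∈ rootSpace H α) (x : H) :
    ⁅(x : L), y⁆ ∈ rootSpace H α :=
  (rootSpace H α).lie_mem (x := x) hy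

variable [CharZero K] [IsAlgClosed K] [FiniteDimensional K L]

lemma lie_sub_smul_mem_radical {α : H → K} {y : L} (hy : y ∈ rootSpace H α) (x : H) :
    ⁅(x : L), y⁆ - α x • y ∈ radical K L := by
  classical
  let π := mkHom (radical K L)
  let H' := H.map π
  obtain ⟨σ, hσ, hσx⟩ : ∃ σ : H' → H, (∀ y : H', π (σ y : L) = y) ∧
      σ ⟨π x, x, x.2, rfl⟩ = x := by
    refine ⟨fun y => if y = ⟨π x, x, x.2, rfl⟩ then x else ⟨y.2.choose, y.2.choose_spec.1⟩,
      fun y => ?_, if_pos rfl⟩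
    by_cases hy : y = ⟨π x, x, x.2, rfl⟩
    · dsimp only
      rw [if_pos hy, hy]
    · dsimp only
      rw [if_neg hy]
      exact y.2.choose_spec.2
  have hmem : π y ∈ rootSpace H' (α ∘ σ) := by
    rw [mem_genWeightSpace]
    intro z
    obtain ⟨k, hk⟩ := (mem_genWeightSpace _ _ _).1 (mkHom_mem_genWeightSpace H _ hy) (σ z)
    refine ⟨k, ?_⟩
    have : toEnd K H' (L ⧸ radical K L) z = toEnd K H (L ⧸ radical K L) (σ z) := by
      refine LinearMap.ext fun s => ?_
      change ⁅(z : L ⧸ radical K L), s⁆ = ⁅(σ z : L), s⁆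
      rw [lie_eq_mkHom_lie, ← hσ z]
    rw [this]
    exact hk
  have h := IsKilling.lie_eq_smul_of_mem_rootSpace hmem ⟨π x, x, x.2, rfl⟩
  rw [Function.comp_apply, hσx] at h
  rw [← mkHom_eq_zero, map_sub, map_smul, LieHom.map_lie, sub_eq_zero]
  exact h

lemma eq_zero_of_mem_center {z : L} (hz : z ∈ center K L) {α : H → K} (hα : α ≠ 0)
    (hz' : z ∈ rootSpace H α) : z = 0 := by
  have h := (disjoint_genWeightSpace K H L hα).le_bot ⟨hz', center_le_rootSpace_zero H hz⟩
  simpa using h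

lemma mem_center_of_mem_radical (hP : AbelianCentral K L) {α : H → K}
    (hα : α = 0 ∨ genWeightSpace (L ⧸ radical K L) α ≠ ⊥) {r : L} (hr : r ∈ radical K L)
    (hr' : r ∈ rootSpace H α) : r ∈ center K L := by
  have h0 := hP.genWeightSpace_radQuot_eq_bot H α hα
  rw [← comap_genWeightSpace_eq_of_injective
    (f := (radQuot K L).incl.restrictLie H) Subtype.val_injective] at h0
  have h1 : radMk (K := K) r hr ∈ (genWeightSpace (L ⧸ center K L) α).comap
      ((radQuot K L).incl.restrictLie H) := mkHom_mem_genWeightSpace H _ hr'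
  rw [h0, LieSubmodule.mem_bot] at h1
  exact radMk_eq_zero.1 h1

theorem AbelianCentral.lie_eq_smul_of_ne_zero (hP : AbelianCentral K L) {α : H → K} (hα : α ≠ 0)
    {y : L} (hy : y ∈ rootSpace H α) (x : H) : ⁅(x : L), y⁆ = α x • y := by
  rw [← sub_eq_zero]
  have hmem : ⁅(x : L), y⁆ - α x • y ∈ rootSpace H α :=
    sub_mem (lie_mem_rootSpace H hy x) (Submodule.smul_mem _ _ hy)
  refine eq_zero_of_mem_center H ?_ hα hmem
  by_cases hS : genWeightSpace (L ⧸ radical K L) α = ⊥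
  · have hyR : y ∈ radical K L := by
      rw [← mkHom_eq_zero]
      have h := mkHom_mem_genWeightSpace H (radical K L) hy
      rwa [hS, LieSubmodule.mem_bot] at h
    have hr : radMk (K := K) y hyR ∈ genWeightSpace (radQuot K L) α := by
      rw [← comap_genWeightSpace_eq_of_injective
        (f := (radQuot K L).incl.restrictLie H) Subtype.val_injective]
      exact mkHom_mem_genWeightSpace H _ hy
    obtain ⟨k, hk⟩ := (mem_genWeightSpace _ _ _).1 hr x
    have htop : Submodule.span K (⋃ χ : H → K, (rootSpace H χ : Set L)) = ⊤ := by
      have h := congrArg LieSubmodule.toSubmodule (iSup_genWeightSpace_eq_top K H L)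
      rw [LieSubmodule.iSup_toSubmodule] at h
      rw [eq_top_iff, ← LieSubmodule.top_toSubmodule (R := K) (L := H), ← h, iSup_le_iff]
      exact fun χ y hy => Submodule.subset_span (Set.mem_iUnion.2 ⟨χ, hy⟩)
    have key := lie_eq_smul_of_isotropic (radBracket K L)
      (fun x v w => hP.radBracket_invariant x v w) (hP.eq_bot_of_isotropic) htop (x : L)
      (fun z hz => ?_) (α x) k (radMk y hyR) hk
    · rw [lie_radMk, ← sub_eq_zero] at key
      exact (mkHom_eq_zero _).1 (congrArg Subtype.val key)
    · obtain ⟨χ, hz⟩ := Set.mem_iUnion.1 hz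
      refine ⟨χ x, fun v => ?_⟩
      have h := hP.radical_lie_radQuot _ (lie_sub_smul_mem_radical H hz x) v
      rw [sub_lie, smul_lie, sub_eq_zero, lie_lie, sub_eq_iff_eq_add] at h
      rw [h]
      abel
  · exact mem_center_of_mem_radical H hP (Or.inr hS) (lie_sub_smul_mem_radical H hy x) hmem

lemma mem_rootSpace_zero_iff {y : L} : y ∈ rootSpace H (0 : H → K) ↔ y ∈ H := by
  rw [rootSpace_zero_eq]; rfl

/-- The centralizer in `H` of `H`. -/
def centralizerIn : Submodule K L where
  carrier := {y | y ∈ H ∧ ∀ x ∈ H, ⁅x, y⁆ = 0}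
  add_mem' := fun ⟨ha, ha'⟩ ⟨hb, hb'⟩ =>
    ⟨add_mem ha hb, fun x hx => by rw [lie_add, ha' x hx, hb' x hx, add_zero]⟩
  zero_mem' := ⟨zero_mem H, fun x _ => lie_zero x⟩
  smul_mem' := fun c a ⟨ha, ha'⟩ =>
    ⟨H.smul_mem c ha, fun x hx => by rw [lie_smul, ha' x hx, smul_zero]⟩

lemma center_le_centralizerIn : (center K L).toSubmodule ≤ centralizerIn H := fun _ hz =>
  ⟨(mem_rootSpace_zero_iff H).1 (center_le_rootSpace_zero H hz), fun x _ => lie_center_eq_zero hz x⟩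

theorem AbelianCentral.top_le (hP : AbelianCentral K L) :
    ⊤ ≤ centralizerIn H ⊔ ⨆ χ : H → K, ⨆ _ : χ ≠ 0, (rootSpace H χ).toSubmodule := by
  set N := centralizerIn H ⊔ ⨆ χ : H → K, ⨆ _ : χ ≠ 0, (rootSpace H χ).toSubmodule with hN
  have hroot : ∀ χ : H → K, χ ≠ 0 → (rootSpace H χ).toSubmodule ≤ N := fun χ hχ =>
    (le_iSup₂ (f := fun (χ : H → K) (_ : χ ≠ 0) => (rootSpace H χ).toSubmodule) χ hχ).trans
      le_sup_right
  have hrad : (radical K L).toSubmodule ≤ N := by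
    let R : LieSubmodule K H L :=
      { (radical K L).toSubmodule with
        lie_mem := fun {x m} hm => lie_mem_right K L _ (x : L) m hm }
    have h := congrArg LieSubmodule.toSubmodule (eq_iSup_inf_genWeightSpace K H L R)
    rw [LieSubmodule.iSup_toSubmodule] at h
    change R.toSubmodule ≤ N
    rw [h, iSup_le_iff]
    rintro χ r ⟨hr, hr'⟩
    by_cases hχ : (χ : H → K) = 0
    · exact Submodule.mem_sup_left
        (center_le_centralizerIn H (mem_center_of_mem_radical H hP (Or.inl hχ) hr hr'))
    · exact hroot χ hχ hr'
  have htop : ⨆ χ : H → K, (rootSpace H χ).toSubmodule = ⊤ := by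
    have h := congrArg LieSubmodule.toSubmodule (iSup_genWeightSpace_eq_top K H L)
    rwa [LieSubmodule.iSup_toSubmodule] at h
  have hlie : ∀ y z : L, ⁅y, z⁆ ∈ N := by
    intro y z
    have hy : y ∈ ⨆ χ : H → K, (rootSpace H χ).toSubmodule := htop ▸ Submodule.mem_top
    have hz : z ∈ ⨆ χ : H → K, (rootSpace H χ).toSubmodule := htop ▸ Submodule.mem_top
    induction hy using Submodule.iSup_induction' with
    | zero => rw [zero_lie]; exact zero_mem N
    | add a b _ _ ha hb => rw [add_lie]; exact add_mem ha hb
    | mem α y hy =>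
      induction hz using Submodule.iSup_induction' with
      | zero => rw [lie_zero]; exact zero_mem N
      | add a b _ _ ha hb => rw [lie_add]; exact add_mem ha hb
      | mem β z hz =>
        have hyz : ⁅y, z⁆ ∈ rootSpace H (α + β) := lie_mem_genWeightSpace_of_mem_genWeightSpace hy hz
        by_cases hαβ : α + β = 0
        · rw [hαβ] at hyz
          refine Submodule.mem_sup_left ?_
          by_cases hα : α = 0
          · have hβ : β = 0 := by rwa [hα, zero_add] at hαβ
            subst hα hβ
            have h := lie_sub_smul_mem_radical H hz ⟨y, (mem_rootSpace_zero_iff H).1 hy⟩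
            rw [Pi.zero_apply, zero_smul, sub_zero] at h
            exact center_le_centralizerIn H (mem_center_of_mem_radical H hP (Or.inl rfl) h hyz)
          · have hβ : β ≠ 0 := fun h => hα (by rwa [h, add_zero] at hαβ)
            refine ⟨(mem_rootSpace_zero_iff H).1 hyz, fun x hx => ?_⟩
            have h1 := hP.lie_eq_smul_of_ne_zero H hα hy ⟨x, hx⟩
            have h2 := hP.lie_eq_smul_of_ne_zero H hβ hz ⟨x, hx⟩
            have h3 : α ⟨x, hx⟩ + β ⟨x, hx⟩ = 0 := congrFun hαβ ⟨x, hx⟩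
            dsimp only at h1 h2
            rw [leibniz_lie, h1, h2, smul_lie, lie_smul, ← add_smul, h3, zero_smul]
        · exact hroot _ hαβ hyz
  intro y _
  have hy : mkHom (radical K L) y ∈
      ⁅(⊤ : LieIdeal K (L ⧸ radical K L)), (⊤ : LieIdeal K (L ⧸ radical K L))⁆ := by
    rw [lie_top_eq_top_of_isKilling]; exact LieSubmodule.mem_top _
  rw [← LieSubmodule.mem_toSubmodule, LieSubmodule.lieIdeal_oper_eq_linear_span'] at hy
  have hle : Submodule.span K {m | ∃ x ∈ (⊤ : LieIdeal K (L ⧸ radical K L)),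
      ∃ n ∈ (⊤ : LieIdeal K (L ⧸ radical K L)), ⁅x, n⁆ = m} ≤
      N.map (mkHom (radical K L) : L →ₗ[K] L ⧸ radical K L) := by
    refine Submodule.span_le.2 ?_
    rintro _ ⟨s, _, t, _, rfl⟩
    obtain ⟨s, rfl⟩ := mkHom_surjective _ s
    obtain ⟨t, rfl⟩ := mkHom_surjective _ t
    exact ⟨⁅s, t⁆, hlie s t, LieHom.map_lie _ s t⟩
  obtain ⟨n, hn, hny⟩ := hle hy
  have hd : n - y ∈ radical K L := by
    rw [← mkHom_eq_zero, map_sub, sub_eq_zero]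
    exact hny
  have := sub_mem hn (hrad hd)
  rwa [sub_sub_cancel] at this

theorem AbelianCentral.lie_eq_zero (hP : AbelianCentral K L) {x y : L} (hx : x ∈ H) (hy : y ∈ H) :
    ⁅x, y⁆ = 0 := by
  obtain ⟨a, ha, l, hl, rfl⟩ := Submodule.mem_sup.1 (hP.top_le H (Submodule.mem_top (x := y)))
  have h0 : l ∈ rootSpace H (0 : H → K) := by
    rw [mem_rootSpace_zero_iff]
    simpa using sub_mem hy ha.1
  have hl' : l ∈ ⨆ χ : H → K, ⨆ _ : χ ≠ 0, rootSpace H χ := by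
    rw [← LieSubmodule.mem_toSubmodule]
    simpa only [LieSubmodule.iSup_toSubmodule] using hl
  have h := (iSupIndep_genWeightSpace K H L 0).le_bot ⟨h0, hl'⟩
  rw [LieSubmodule.mem_bot] at h
  rw [h, add_zero]
  exact ha.2 x hx

end Cartan

section Toral

open LieAlgebra LieModule

variable {k L : Type*} [Field k] [LieRing L] [LieAlgebra k L]

lemma apply_eq_zero_of_apply_apply_eq_zero {V : Type*} [AddCommGroup V] [Module k V]
    {T : Module.End k V} (hT : ⨆ c, T.eigenspace c = ⊤) {v : V} (hv : T (T v) = 0) : T v = 0 := by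
  have h1 : T v ∈ ⨆ c, ⨆ _ : c ≠ 0, T.eigenspace c := by
    have hvT : v ∈ ⨆ c, T.eigenspace c := hT ▸ Submodule.mem_top
    clear hv
    induction hvT using Submodule.iSup_induction' with
    | mem c v hv =>
      rw [Module.End.mem_eigenspace_iff.1 hv]
      by_cases hc : c = 0
      · rw [hc, zero_smul]; exact zero_mem _
      · exact Submodule.mem_iSup_of_mem c (Submodule.mem_iSup_of_mem hc
          (Submodule.smul_mem _ c hv))
    | zero => rw [map_zero]; exact zero_mem _
    | add a b _ _ ha hb => rw [map_add]; exact add_mem ha hb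
  have h0 : T v ∈ T.eigenspace 0 := Module.End.mem_eigenspace_iff.2 (by rw [hv, zero_smul])
  exact (Submodule.mem_bot k).1 ((Module.End.eigenspaces_iSupIndep T 0).le_bot ⟨h0, h1⟩)

/-- The centralizer of a subset of a Lie algebra. -/
def lieCentralizer (t : Set L) : LieSubalgebra k L where
  carrier := {y | ∀ x ∈ t, ⁅x, y⁆ = 0}
  add_mem' := fun ha hb x hx => by rw [lie_add, ha x hx, hb x hx, add_zero]
  zero_mem' := fun x _ => lie_zero x
  smul_mem' := fun c a ha x hx => by rw [lie_smul, ha x hx, smul_zero]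
  lie_mem' := fun {a b} ha hb x hx => by
    rw [leibniz_lie, ha x hx, hb x hx, zero_lie, lie_zero, add_zero]

end Toral

section MaxToral

open LieAlgebra LieModule

variable {k L : Type} [Field k] [IsAlgClosed k] [CharZero k] [LieRing L] [LieAlgebra k L]
  [FiniteDimensional k L]

lemma AbelianCentral.iSup_adWeightSpace_eq_top (hP : AbelianCentral k L) (H : LieSubalgebra k L)
    [H.IsCartanSubalgebra] : ⨆ α : Module.Dual k H, adWeightSpace k L H α = ⊤ := by
  have h := congrArg LieSubmodule.toSubmodule (iSup_genWeightSpace_eq_top' k H L)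
  rw [LieSubmodule.iSup_toSubmodule] at h
  rw [eq_top_iff, ← LieSubmodule.top_toSubmodule (R := k) (L := H), ← h, iSup_le_iff]
  intro χ y hy
  refine Submodule.mem_iSup_of_mem (Weight.toLinear k H L χ) fun x => ?_
  change ⁅(x : L), y⁆ = χ x • y
  by_cases hχ : (χ : H → k) = 0
  · rw [hχ] at hy ⊢
    rw [hP.lie_eq_zero H x.2 ((mem_rootSpace_zero_iff H).1 hy), Pi.zero_apply, zero_smul]
  · exact hP.lie_eq_smul_of_ne_zero H hχ hy x

theorem AbelianCentral.mem_of_forall_lie_eq_zero (hP : AbelianCentral k L) (t : LieSubalgebra k L)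
    (hab : ∀ x ∈ t, ∀ y ∈ t, ⁅x, y⁆ = 0)
    (hspan : ∀ x ∈ t, ⨆ c, (toEnd k L L x).eigenspace c = ⊤)
    (hmax : ∀ t' : LieSubalgebra k L, (∀ x ∈ t', ∀ y ∈ t', ⁅x, y⁆ = 0) →
      ⨆ α : Module.Dual k t', adWeightSpace k L t' α = ⊤ → t ≤ t' → t' = t)
    {y : L} (hy : ∀ x ∈ t, ⁅x, y⁆ = 0) : y ∈ t := by
  let C : LieSubalgebra k L := lieCentralizer (t : Set L)
  obtain ⟨c, hc⟩ := exists_isCartanSubalgebra_engel k C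
  set H' := LieSubalgebra.engel k c
  have hself : ∀ z : C, (∀ w ∈ H', ⁅z, w⁆ ∈ H') → z ∈ H' := fun z hz => by
    rw [← hc.self_normalizing]
    exact (LieSubalgebra.mem_normalizer_iff' _ _).2 fun w hw => by
      rw [← lie_skew]; exact neg_mem (hz w hw)
  let H : LieSubalgebra k L := H'.map C.incl
  have hHC : ∀ z, z ∈ H ↔ ∃ h : z ∈ C, (⟨z, h⟩ : C) ∈ H' := by
    intro z
    constructor
    · rintro ⟨w, hw, rfl⟩
      exact ⟨w.2, hw⟩
    · rintro ⟨h, h'⟩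
      exact ⟨_, h', rfl⟩
  have htC : t ≤ C := fun x hx z hz => hab z hz x hx
  have htH : t ≤ H := fun x hx => (hHC x).2 ⟨htC hx, hself _ fun w hw => by
    have : ⁅(⟨x, htC hx⟩ : C), w⁆ = 0 := Subtype.ext (w.2 x hx)
    rw [this]; exact zero_mem _⟩
  have hselfH : ∀ z : L, (∀ w ∈ H, ⁅z, w⁆ ∈ H) → z ∈ H := by
    intro z hz
    have hzC : z ∈ C := fun x hx => by
      refine apply_eq_zero_of_apply_apply_eq_zero (hspan x hx) ?_
      have h1 : ⁅z, x⁆ ∈ C := ((hHC _).1 (hz x (htH hx))).1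
      have h2 := h1 x hx
      change ⁅x, ⁅x, z⁆⁆ = 0
      rw [← lie_skew x z, lie_neg, h2, neg_zero]
    refine (hHC z).2 ⟨hzC, hself _ fun w hw => ?_⟩
    exact ((hHC _).1 (hz w ((hHC w).2 ⟨w.2, hw⟩))).2
  have hHcartan : H.IsCartanSubalgebra := by
    refine ⟨?_, le_antisymm (fun z hz => hselfH z fun w hw => ?_) (LieSubalgebra.le_normalizer H)⟩
    · have := hc.nilpotent
      let f : H' →ₗ⁅k⁆ H :=
        { toFun := fun w => ⟨(w : C), w, w.2, rfl⟩
          map_add' := fun _ _ => rfl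
          map_smul' := fun _ _ => rfl
          map_lie' := fun {_ _} => rfl }
      have hf : Function.Surjective f := by
        rintro ⟨_, w, hw, rfl⟩
        exact ⟨⟨w, hw⟩, rfl⟩
      exact hf.lieAlgebra_isNilpotent
    · exact (LieSubalgebra.mem_normalizer_iff _ _).1 hz w hw
  have hHt : H = t := hmax H (fun x hx y hy => hP.lie_eq_zero H hx hy)
    (hP.iSup_adWeightSpace_eq_top H) htH
  rw [← hHt]
  refine hselfH y fun w hw => ?_
  rw [← lie_skew, hy w (hHt ▸ hw), neg_zero]
  exact zero_mem H

end MaxToral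

namespace Setup

variable {K : Type} [Field K] [IsAlgClosed K] [CharZero K]
variable {g : Type} [LieRing g] [LieAlgebra K g]
variable (S : Setup K g)

lemma lie_h_h {x y : g} (hx : x ∈ S.h) (hy : y ∈ S.h) : ⁅x, y⁆ = 0 := by
  obtain ⟨n, hn⟩ := S.F_exhaust x
  obtain ⟨m, hm⟩ := S.F_exhaust y
  have hx' : x ∈ S.h ⊓ S.F (max n m) := ⟨hx, S.F_mono (le_max_left n m) hn⟩
  have hy' : y ∈ S.h ⊓ S.F (max n m) := ⟨hy, S.F_mono (le_max_right n m) hm⟩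
  have := (S.h_maxToral (max n m)).1.2.1
  exact congrArg Subtype.val (this.trivial ⟨x, hx'⟩ ⟨y, hy'⟩)

theorem adWeightSpace_zero_le : adWeightSpace K g S.h 0 ≤ S.h.toSubmodule := by
  intro y hy
  obtain ⟨n, hn⟩ := S.F_exhaust y
  have := S.F_findim n
  obtain ⟨⟨hle, hab, hspan⟩, hmax⟩ := S.h_maxToral n
  set t := S.h ⊓ S.F n
  let t' : LieSubalgebra K (S.F n) := t.comap (S.F n).incl
  refine (AbelianCentral.mem_of_forall_lie_eq_zero (S.F_reductive n) t'
    (fun x hx z hz => Subtype.ext (S.lie_h_h hx.1 hz.1)) (fun x hx => ?_)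
    (fun u hu husp htu => ?_) (y := ⟨y, hn⟩) fun x hx => Subtype.ext ?_ : (⟨y, hn⟩ : S.F n) ∈ t').1
  · rw [eq_top_iff]
    rintro z -
    have hz := hspan z.2
    have hle : ⨆ α : Module.Dual K t, (S.F n).toSubmodule ⊓ adWeightSpace K g t α ≤
        (⨆ c, (LieModule.toEnd K (S.F n) (S.F n) x).eigenspace c).map (S.F n).toSubmodule.subtype := by
      rw [iSup_le_iff]
      rintro α w ⟨hw, hw'⟩
      exact ⟨⟨w, hw⟩, Submodule.mem_iSup_of_mem (α ⟨x, hx⟩)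
        (Module.End.mem_eigenspace_iff.2 (Subtype.ext (hw' ⟨x, hx⟩))), rfl⟩
    obtain ⟨w, hw, hwz⟩ := hle hz
    rwa [← Subtype.ext hwz]
  · have hv : IsToralIn K g (S.F n) (u.map (S.F n).incl) := by
      refine ⟨?_, ⟨?_⟩, ?_⟩
      · rintro _ ⟨w, _, rfl⟩
        exact w.2
      · rintro ⟨_, a, ha, rfl⟩ ⟨_, b, hb, rfl⟩
        exact Subtype.ext (congrArg (fun w : S.F n => (w : g)) (hu a ha b hb))
      · intro z hz
        have hz' : (⟨z, hz⟩ : S.F n) ∈ ⨆ α : Module.Dual K u, adWeightSpace K (S.F n) u α :=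
          husp ▸ Submodule.mem_top
        have := Submodule.mem_map_of_mem (f := (S.F n).toSubmodule.subtype) hz'
        rw [Submodule.map_iSup] at this
        refine (iSup_le fun α => ?_ : _ ≤ ⨆ α : Module.Dual K (u.map (S.F n).incl),
          (S.F n).toSubmodule ⊓ adWeightSpace K g (u.map (S.F n).incl) α) this
        let e : (u.map (S.F n).incl) →ₗ[K] u :=
          { toFun := fun w => ⟨⟨w, by obtain ⟨a, _, h⟩ := w.2; exact h ▸ a.2⟩, by
              obtain ⟨a, ha, h⟩ := w.2
              have : a = ⟨w, by exact h ▸ a.2⟩ := Subtype.ext h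
              exact this ▸ ha⟩
            map_add' := fun _ _ => rfl
            map_smul' := fun _ _ => rfl }
        refine le_trans ?_ (le_iSup _ (α.comp e))
        rintro _ ⟨w, hw, rfl⟩
        refine ⟨w.2, fun H => ?_⟩
        exact congrArg Subtype.val (hw (e H))
    have htv : t ≤ u.map (S.F n).incl := fun x hx =>
      ⟨⟨x, hx.2⟩, htu (show (⟨x, hx.2⟩ : S.F n) ∈ t' from hx), rfl⟩
    have h := hmax _ hv htv
    refine le_antisymm (fun x hx => ?_) htu
    have : (x : g) ∈ t := h ▸ ⟨x, hx, rfl⟩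
    exact this
  · have := hy ⟨x, hx.1⟩
    rw [LinearMap.zero_apply, zero_smul] at this
    exact this

end Setup

section Enveloping

open UniversalEnvelopingAlgebra

variable {k L : Type*} [Field k] [LieRing L] [LieAlgebra k L]

/-- The algebra map out of the enveloping algebra induced by a linear map which turns brackets
into commutators. -/
def ueaLift {A : Type*} [Ring A] [Algebra k A] (f : L →ₗ[k] A)
    (hf : ∀ x y, f ⁅x, y⁆ = f x * f y - f y * f x) : UniversalEnvelopingAlgebra k L →ₐ[k] A :=
  letI : LieRing A := LieRing.ofAssociativeRing
  lift k { f with map_lie' := fun {x y} => hf x y }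

lemma ueaLift_ι {A : Type*} [Ring A] [Algebra k A] (f : L →ₗ[k] A)
    (hf : ∀ x y, f ⁅x, y⁆ = f x * f y - f y * f x) (x : L) : ueaLift f hf (ι k x) = f x :=
  letI : LieRing A := LieRing.ofAssociativeRing
  lift_ι_apply k _ x

lemma ι_lie (x y : L) : ι k ⁅x, y⁆ = ι k x * ι k y - ι k y * ι k x :=
  letI : LieRing (UniversalEnvelopingAlgebra k L) := LieRing.ofAssociativeRing
  LieHom.map_lie (ι k) x y

lemma uea_hom_ext {A : Type*} [Ring A] [Algebra k A] {f g : UniversalEnvelopingAlgebra k L →ₐ[k] A}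
    (h : ∀ x, f (ι k x) = g (ι k x)) : f = g :=
  letI : LieRing A := LieRing.ofAssociativeRing
  hom_ext k (LieHom.ext h)

/-- The linear map underlying `ι`. -/
def ιLin : L →ₗ[k] UniversalEnvelopingAlgebra k L where
  toFun := ι k
  map_add' := map_add (ι k)
  map_smul' := map_smul (ι k)

theorem uea_eq_top (W : Submodule k (UniversalEnvelopingAlgebra k L)) (h1 : 1 ∈ W)
    (hW : ∀ x, ∀ w ∈ W, ι k x * w ∈ W) : W = ⊤ := by
  let B : Subalgebra k (UniversalEnvelopingAlgebra k L) :=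
    { carrier := {u | ∀ w ∈ W, u * w ∈ W}
      mul_mem' := fun {a b} ha hb w hw => by rw [mul_assoc]; exact ha _ (hb w hw)
      add_mem' := fun {a b} ha hb w hw => by rw [add_mul]; exact add_mem (ha w hw) (hb w hw)
      algebraMap_mem' := fun c w hw => by
        rw [← Algebra.smul_def]; exact W.smul_mem c hw }
  let j : L →ₗ[k] B := (ιLin (k := k) (L := L)).codRestrict (Subalgebra.toSubmodule B) fun x w hw => hW x w hw
  let φ : UniversalEnvelopingAlgebra k L →ₐ[k] B :=
    ueaLift j fun x y => Subtype.ext (ι_lie x y)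
  have hφ : B.val.comp φ = AlgHom.id k _ := uea_hom_ext fun x => by
    change ((φ (ι k x) : B) : UniversalEnvelopingAlgebra k L) = ι k x
    rw [ueaLift_ι]; rfl
  refine Submodule.eq_top_iff'.2 fun u => ?_
  have hu : ((φ u : B) : UniversalEnvelopingAlgebra k L) = u := DFunLike.congr_fun hφ u
  have := (φ u).2 1 h1
  rwa [mul_one, hu] at this

instance uea_nontrivial : Nontrivial (UniversalEnvelopingAlgebra k L) :=
  (ueaLift (0 : L →ₗ[k] k) fun x y => by simp).toRingHom.domain_nontrivial

variable (a : LieSubalgebra k L)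

/-- The action of `a` on linear maps from `L` to the enveloping algebra of `a`. -/
def homAction : a →ₗ[k] Module.End k (L →ₗ[k] UniversalEnvelopingAlgebra k a) :=
  LinearMap.mk₂ k
    (fun x f => LinearMap.mulLeft k (ι k x) ∘ₗ f - f ∘ₗ (LieModule.toEnd k L L x : L →ₗ[k] L))
    (fun x y f => by
      refine LinearMap.ext fun z => ?_
      simp [add_mul]; abel)
    (fun c x f => by
      refine LinearMap.ext fun z => ?_
      simp [smul_sub])
    (fun x f g => by
      refine LinearMap.ext fun z => ?_
      simp [mul_add]; abel)
    (fun c x f => by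
      refine LinearMap.ext fun z => ?_
      simp [smul_sub])

lemma homAction_apply (x : a) (f : L →ₗ[k] UniversalEnvelopingAlgebra k a) (z : L) :
    homAction a x f z = ι k x * f z - f ⁅(x : L), z⁆ := rfl

lemma homAction_lie (x y : a) : homAction a ⁅x, y⁆ =
    homAction a x * homAction a y - homAction a y * homAction a x := by
  refine LinearMap.ext fun f => LinearMap.ext fun z => ?_
  rw [LinearMap.sub_apply, LinearMap.sub_apply, Module.End.mul_apply, Module.End.mul_apply]
  simp only [homAction_apply, ι_lie, LieSubalgebra.coe_bracket, lie_lie, map_sub, sub_mul, mul_sub,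
    mul_assoc]
  abel

variable (p : L →ₗ[k] a) (χ : L →ₗ[k] k)

/-- The action of `1` in the induced module. -/
def unitAction : L →ₗ[k] UniversalEnvelopingAlgebra k a :=
  ιLin ∘ₗ p + Algebra.linearMap k _ ∘ₗ χ

/-- The action of the enveloping algebra of `a` on linear maps from `L` to itself. -/
def homHom : UniversalEnvelopingAlgebra k a →ₐ[k]
    Module.End k (L →ₗ[k] UniversalEnvelopingAlgebra k a) :=
  ueaLift (A := Module.End k (L →ₗ[k] UniversalEnvelopingAlgebra k a)) (homAction a)
    (homAction_lie a)

/-- The action of `L` on the enveloping algebra of `a`, extending left multiplication. -/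
def indAction : L →ₗ[k] Module.End k (UniversalEnvelopingAlgebra k a) :=
  LinearMap.mk₂ k (fun z u => homHom a u (unitAction a p χ) z)
    (fun _ _ _ => map_add _ _ _)
    (fun _ _ _ => map_smul _ _ _)
    (fun z u v => by rw [map_add]; rfl)
    (fun c z u => by rw [map_smul]; rfl)

lemma indAction_one (z : L) :
    indAction a p χ z 1 = ι k (p z) + algebraMap k _ (χ z) := by
  change homHom a 1 (unitAction a p χ) z = _
  rw [map_one]
  rfl

lemma indAction_mul (z : L) (x : a) (u : UniversalEnvelopingAlgebra k a) :
    indAction a p χ z (ι k x * u) = ι k x * indAction a p χ z u - indAction a p χ ⁅(x : L), z⁆ u := by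
  change homHom a (ι k x * u) (unitAction a p χ) z = _
  rw [map_mul, homHom, ueaLift_ι]
  rfl

lemma uea_induction {P : UniversalEnvelopingAlgebra k L → Prop} (h1 : P 1)
    (hmul : ∀ x u, P u → P (ι k x * u)) (hadd : ∀ u v, P u → P v → P (u + v))
    (hsmul : ∀ (c : k) u, P u → P (c • u)) (u : UniversalEnvelopingAlgebra k L) : P u := by
  let W : Submodule k (UniversalEnvelopingAlgebra k L) :=
    { carrier := {u | P u}
      add_mem' := fun {u v} hu hv => hadd u v hu hv
      zero_mem' := by
        have := hsmul 0 1 h1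
        rwa [zero_smul] at this
      smul_mem' := fun c u hu => hsmul c u hu }
  have := uea_eq_top W h1 hmul
  exact (this ▸ Submodule.mem_top : u ∈ W)

variable {a p χ}

lemma indAction_of_mem (hp : ∀ x : a, p x = x) (hχ : ∀ x : a, χ x = 0) (x : a)
    (u : UniversalEnvelopingAlgebra k a) : indAction a p χ x u = ι k x * u := by
  induction u using uea_induction generalizing x with
  | h1 => rw [indAction_one, hp, hχ, map_zero, add_zero, mul_one]
  | hmul y u ih =>
    rw [indAction_mul, ih, ← LieSubalgebra.coe_bracket, ih, ι_lie]
    noncomm_ring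
  | hadd u v hu hv => rw [map_add, hu, hv, mul_add]
  | hsmul c u hu => rw [map_smul, hu, mul_smul_comm]

lemma indAction_lie (hp : ∀ x : a, p x = x) (hχ : ∀ x : a, χ x = 0)
    (hpb : ∀ z w, p z = 0 → p w = 0 → p ⁅z, w⁆ = 0)
    (hχb : ∀ z w, p z = 0 → p w = 0 → χ ⁅z, w⁆ = 0) (u : UniversalEnvelopingAlgebra k a) :
    ∀ z w : L, indAction a p χ ⁅z, w⁆ u =
      indAction a p χ z (indAction a p χ w u) - indAction a p χ w (indAction a p χ z u) := by
  induction u using uea_induction with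
  | h1 =>
    have ha : ∀ (x : a) (w : L) u, indAction a p χ ⁅(x : L), w⁆ u =
        indAction a p χ x (indAction a p χ w u) - indAction a p χ w (indAction a p χ x u) := by
      intro x w u
      rw [indAction_of_mem hp hχ, indAction_of_mem hp hχ, indAction_mul]
      abel
    have hb : ∀ z w : L, p z = 0 → p w = 0 → indAction a p χ ⁅z, w⁆ 1 =
        indAction a p χ z (indAction a p χ w 1) - indAction a p χ w (indAction a p χ z 1) := by
      intro z w hz hw
      simp only [indAction_one, hz, hw, hpb z w hz hw, hχb z w hz hw, map_zero, zero_add,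
        Algebra.algebraMap_eq_smul_one, map_smul]
      rw [smul_comm, sub_self]
    intro z w
    obtain ⟨z', hz', hz⟩ : ∃ z', p z' = 0 ∧ z = p z + z' :=
      ⟨z - p z, by rw [map_sub, hp, sub_self], by abel⟩
    obtain ⟨w', hw', hw⟩ : ∃ w', p w' = 0 ∧ w = p w + w' :=
      ⟨w - p w, by rw [map_sub, hp, sub_self], by abel⟩
    have h1 := ha (p z) w 1
    have h2 := ha (p w) z' 1
    rw [← lie_skew, map_neg, LinearMap.neg_apply, neg_eq_iff_eq_neg, neg_sub] at h2
    have h3 := hb z' w' hz' hw'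
    rw [hz, add_lie, map_add, LinearMap.add_apply, h1]
    have h4 : indAction a p χ ⁅z', w⁆ 1 =
        indAction a p χ z' (indAction a p χ w 1) - indAction a p χ w (indAction a p χ z' 1) := by
      rw [hw, lie_add]
      simp only [map_add, LinearMap.add_apply, h2, h3]
      abel
    rw [h4]
    simp only [map_add, LinearMap.add_apply]
    abel
  | hmul x u ih =>
    intro z w
    have h : ⁅(x : L), ⁅z, w⁆⁆ = ⁅⁅(x : L), z⁆, w⁆ + ⁅z, ⁅(x : L), w⁆⁆ := leibniz_lie _ _ _
    simp only [indAction_mul, map_sub, h, map_add, LinearMap.add_apply, ih, mul_sub]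
    abel
  | hadd u v hu hv =>
    intro z w
    simp only [map_add, hu, hv]
    abel
  | hsmul c u hu =>
    intro z w
    simp only [map_smul, hu, smul_sub]

/-- Nonvanishing of induced modules: the left ideal of the enveloping algebra of `L = a ⊕ b`
attached to a character of `b` is proper. -/
theorem one_notMem_span (hp : ∀ x : a, p x = x) (hχ : ∀ x : a, χ x = 0)
    (hpb : ∀ z w, p z = 0 → p w = 0 → p ⁅z, w⁆ = 0)
    (hχb : ∀ z w, p z = 0 → p w = 0 → χ ⁅z, w⁆ = 0) :
    (1 : UniversalEnvelopingAlgebra k L) ∉ Submodule.span (UniversalEnvelopingAlgebra k L)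
      {u | ∃ z : L, p z = 0 ∧ u = ι k z - algebraMap k _ (χ z)} := by
  intro h
  let Φ : UniversalEnvelopingAlgebra k L →ₐ[k] Module.End k (UniversalEnvelopingAlgebra k a) :=
    ueaLift (indAction a p χ) fun z w => LinearMap.ext fun u => indAction_lie hp hχ hpb hχb u z w
  let J : Submodule (UniversalEnvelopingAlgebra k L) (UniversalEnvelopingAlgebra k L) :=
    { carrier := {u | Φ u 1 = 0}
      add_mem' := fun {u v} hu hv => by
        change Φ (u + v) 1 = 0
        rw [map_add, LinearMap.add_apply, hu, hv, add_zero]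
      zero_mem' := by
        change Φ 0 1 = 0
        rw [map_zero, LinearMap.zero_apply]
      smul_mem' := fun c u hu => by
        change Φ (c * u) 1 = 0
        rw [map_mul, Module.End.mul_apply, hu, map_zero] }
  have hJ : Submodule.span (UniversalEnvelopingAlgebra k L)
      {u | ∃ z : L, p z = 0 ∧ u = ι k z - algebraMap k _ (χ z)} ≤ J := Submodule.span_le.2 <| by
    rintro _ ⟨z, hz, rfl⟩
    change Φ (ι k z - algebraMap k _ (χ z)) 1 = 0
    rw [map_sub, ueaLift_ι, LinearMap.sub_apply, indAction_one, hz, map_zero, zero_add,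
      AlgHom.commutes, Module.algebraMap_end_apply, Algebra.algebraMap_eq_smul_one, sub_self]
  have h1 : Φ 1 1 = 0 := hJ h
  rw [map_one Φ] at h1
  change (1 : UniversalEnvelopingAlgebra k a) = 0 at h1
  exact one_ne_zero h1

end Enveloping

namespace Setup

section Roots

variable {K : Type} [Field K] [IsAlgClosed K] [CharZero K]
variable {g : Type} [LieRing g] [LieAlgebra K g]
variable (S : Setup K g)

/-- The sum of the weight spaces of `g` with weights in a given set. -/
def weightSum (A : Set (Module.Dual K S.h)) : Submodule K g := ⨆ α ∈ A, adWeightSpace K g S.h α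

/-- The set of negative roots. -/
def negRoots : Set (Module.Dual K S.h) := {α | IsRootOf K g S.h α ∧ α ∉ S.pos}

variable {S}

lemma neg_mem_pos {α : Module.Dual K S.h} (hα : α ∈ S.negRoots) : -α ∈ S.pos := by
  by_contra h
  exact hα.2 ((S.pos_polar α hα.1).2 h)

lemma ne_zero_of_mem_pos {α : Module.Dual K S.h} (hα : α ∈ S.pos) : α ≠ 0 := (S.pos_root α hα).1

lemma lie_mem_adWeightSpace {α β : Module.Dual K S.h} {x y : g}
    (hx : x ∈ adWeightSpace K g S.h α) (hy : y ∈ adWeightSpace K g S.h β) :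
    ⁅x, y⁆ ∈ adWeightSpace K g S.h (α + β) := fun H => by
  rw [leibniz_lie, hx H, hy H, smul_lie, lie_smul, LinearMap.add_apply, add_smul]

lemma adWeightSpace_zero : adWeightSpace K g S.h 0 = S.h.toSubmodule :=
  le_antisymm S.adWeightSpace_zero_le fun x hx H => by
    rw [S.lie_h_h H.2 hx, LinearMap.zero_apply, zero_smul]

lemma weightSum_zero : S.weightSum {0} = S.h.toSubmodule := by
  rw [weightSum, iSup_singleton, adWeightSpace_zero]

lemma weightSum_pos : S.weightSum S.pos = S.nplus := rfl

lemma weightSum_union (A B : Set (Module.Dual K S.h)) :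
    S.weightSum (A ∪ B) = S.weightSum A ⊔ S.weightSum B := iSup_union

lemma lie_mem_weightSum {A B C : Set (Module.Dual K S.h)}
    (h : ∀ α ∈ A, ∀ β ∈ B, adWeightSpace K g S.h (α + β) ≠ ⊥ → α + β ∈ C) {x y : g}
    (hx : x ∈ S.weightSum A) (hy : y ∈ S.weightSum B) : ⁅x, y⁆ ∈ S.weightSum C := by
  have hxy {α β : Module.Dual K S.h} (hα : α ∈ A) (hβ : β ∈ B) {x y : g}
      (hx : x ∈ adWeightSpace K g S.h α) (hy : y ∈ adWeightSpace K g S.h β) :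
      ⁅x, y⁆ ∈ S.weightSum C := by
    have hm := lie_mem_adWeightSpace hx hy
    by_cases h0 : adWeightSpace K g S.h (α + β) = ⊥
    · rw [h0, Submodule.mem_bot] at hm
      rw [hm]
      exact zero_mem _
    · exact Submodule.mem_iSup_of_mem _ (Submodule.mem_iSup_of_mem (h α hα β hβ h0) hm)
  have hy' {α : Module.Dual K S.h} (hα : α ∈ A) {x : g}
      (hx : x ∈ adWeightSpace K g S.h α) : ⁅x, y⁆ ∈ S.weightSum C :=
    (iSup₂_le fun β hβ y hy => hxy hα hβ hx hy : S.weightSum B ≤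
      (S.weightSum C).comap (LieModule.toEnd K g g x : g →ₗ[K] g)) hy
  rw [← neg_mem_iff, lie_skew]
  exact (iSup₂_le fun α hα x hx => by
    change ⁅y, x⁆ ∈ S.weightSum C
    rw [← neg_mem_iff, lie_skew]
    exact hy' hα hx : S.weightSum A ≤
      (S.weightSum C).comap (LieModule.toEnd K g g y : g →ₗ[K] g)) hx

lemma disjoint_weightSum {A B : Set (Module.Dual K S.h)} (h : Disjoint A B) :
    Disjoint (S.weightSum A) (S.weightSum B) := S.h_indep.disjoint_biSup_biSup h

lemma weightSum_eq_top : S.weightSum S.negRoots ⊔ (S.h.toSubmodule ⊔ S.nplus) = ⊤ := by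
  rw [← weightSum_zero, ← weightSum_pos, eq_top_iff, ← S.h_span, iSup_le_iff]
  intro α
  by_cases h0 : α = 0
  · rw [h0]
    exact (le_biSup (adWeightSpace K g S.h) (Set.mem_singleton 0)).trans
      (le_sup_left.trans le_sup_right)
  · by_cases hp : α ∈ S.pos
    · exact (le_biSup (adWeightSpace K g S.h) hp).trans (le_sup_right.trans le_sup_right)
    · by_cases hb : adWeightSpace K g S.h α = ⊥
      · rw [hb]; exact bot_le
      · have hα : α ∈ S.negRoots := ⟨⟨h0, hb⟩, hp⟩
        exact (le_biSup (adWeightSpace K g S.h) hα).trans le_sup_left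

lemma zero_notMem_pos : (0 : Module.Dual K S.h) ∉ S.pos := fun h => ne_zero_of_mem_pos h rfl

lemma zero_notMem_negRoots : (0 : Module.Dual K S.h) ∉ S.negRoots := fun h => h.1.1 rfl

lemma disjoint_pos_negRoots : Disjoint S.pos S.negRoots :=
  Set.disjoint_left.2 fun _ h h' => h'.2 h

lemma add_mem_pos {α β : Module.Dual K S.h} (hα : α ∈ S.pos) (hβ : β ∈ S.pos)
    (h : adWeightSpace K g S.h (α + β) ≠ ⊥) : α + β ∈ S.pos := by
  refine S.pos_add α hα β hβ ⟨fun h0 => ?_, h⟩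
  exact (S.pos_polar α (S.pos_root α hα)).1 hα (neg_eq_of_add_eq_zero_right h0 ▸ hβ)

lemma add_mem_negRoots {α β : Module.Dual K S.h} (hα : α ∈ S.negRoots) (hβ : β ∈ S.negRoots)
    (h : adWeightSpace K g S.h (α + β) ≠ ⊥) : α + β ∈ S.negRoots := by
  have hr : IsRootOf K g S.h (α + β) :=
    ⟨fun h0 => hβ.2 (neg_eq_of_add_eq_zero_right h0 ▸ neg_mem_pos hα), h⟩
  exact ⟨hr, S.neg_add α β hα.1 hβ.1 hα.2 hβ.2 hr⟩

lemma lie_h_nplus {x y : g} (hx : x ∈ S.h) (hy : y ∈ S.nplus) : ⁅x, y⁆ ∈ S.nplus := by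
  rw [← LieSubalgebra.mem_toSubmodule, ← weightSum_zero] at hx
  refine lie_mem_weightSum (A := {0}) (B := S.pos) (C := S.pos) (fun α hα β hβ _ => ?_) hx hy
  rw [Set.mem_singleton_iff.1 hα, zero_add]
  exact hβ

lemma lie_nplus_nplus {x y : g} (hx : x ∈ S.nplus) (hy : y ∈ S.nplus) : ⁅x, y⁆ ∈ S.nplus :=
  lie_mem_weightSum (fun _ hα _ hβ h => add_mem_pos hα hβ h) hx hy

lemma lie_borel {x y : g} (hx : x ∈ S.h.toSubmodule ⊔ S.nplus)
    (hy : y ∈ S.h.toSubmodule ⊔ S.nplus) : ⁅x, y⁆ ∈ S.nplus := by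
  obtain ⟨a, ha, b, hb, rfl⟩ := Submodule.mem_sup.1 hx
  obtain ⟨c, hc, d, hd, rfl⟩ := Submodule.mem_sup.1 hy
  rw [add_lie, lie_add, lie_add, S.lie_h_h ha hc, zero_add, ← lie_skew b c]
  exact add_mem (lie_h_nplus ha hd) (add_mem (neg_mem (lie_h_nplus hc hb)) (lie_nplus_nplus hb hd))

variable (S) in
/-- The subalgebra spanned by the negative root spaces. -/
def nminus : LieSubalgebra K g where
  __ := S.weightSum S.negRoots
  lie_mem' := fun hx hy => lie_mem_weightSum (fun _ hα _ hβ h => add_mem_negRoots hα hβ h) hx hy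

lemma isCompl_nminus_borel : IsCompl S.nminus.toSubmodule (S.h.toSubmodule ⊔ S.nplus) := by
  refine ⟨?_, codisjoint_iff.2 weightSum_eq_top⟩
  rw [← weightSum_zero, ← weightSum_pos, ← weightSum_union]
  refine disjoint_weightSum (Set.disjoint_left.2 fun α hα hα' => ?_)
  rcases hα' with h | h
  · exact zero_notMem_negRoots (Set.mem_singleton_iff.1 h ▸ hα)
  · exact hα.2 h

lemma isCompl_h : IsCompl S.h.toSubmodule (S.nplus ⊔ S.nminus.toSubmodule) := by
  refine ⟨?_, codisjoint_iff.2 ?_⟩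
  · change Disjoint _ (S.nplus ⊔ S.weightSum S.negRoots)
    rw [← weightSum_zero, ← weightSum_pos, ← weightSum_union]
    refine disjoint_weightSum (Set.disjoint_singleton_left.2 ?_)
    rintro (h | h)
    · exact zero_notMem_pos h
    · exact zero_notMem_negRoots h
  · rw [← sup_assoc, sup_comm]
    exact weightSum_eq_top

/-- The canonical generator of the Verma module is nonzero. -/
theorem one_notMem_vermaIdeal (lam : Module.Dual K S.h) : (1 : Env K g) ∉ S.vermaIdeal lam := by
  let p : g →ₗ[K] S.nminus := S.nminus.toSubmodule.projectionOnto _ isCompl_nminus_borel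
  let q : g →ₗ[K] S.h := S.h.toSubmodule.projectionOnto _ isCompl_h
  have hp0 (z : g) : p z = 0 ↔ z ∈ S.h.toSubmodule ⊔ S.nplus :=
    Submodule.projectionOnto_apply_eq_zero_iff _
  have hq0 (z : g) : q z = 0 ↔ z ∈ S.nplus ⊔ S.nminus.toSubmodule :=
    Submodule.projectionOnto_apply_eq_zero_iff _
  have hχ {z : g} (hz : z ∈ S.nplus ⊔ S.nminus.toSubmodule) : (lam ∘ₗ q) z = 0 := by
    rw [LinearMap.comp_apply, (hq0 z).2 hz, map_zero]
  have key := one_notMem_span (a := S.nminus) (p := p) (χ := lam ∘ₗ q)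
    (fun x => Submodule.projectionOnto_apply_left _ x)
    (fun x => hχ (Submodule.mem_sup_right x.2))
    (fun z w hz hw => (hp0 _).2 (Submodule.mem_sup_right
      (lie_borel ((hp0 z).1 hz) ((hp0 w).1 hw))))
    (fun z w hz hw => hχ (Submodule.mem_sup_left
      (lie_borel ((hp0 z).1 hz) ((hp0 w).1 hw))))
  refine fun h => key (Submodule.span_mono ?_ h)
  rintro _ (⟨x, hx, rfl⟩ | ⟨H, rfl⟩)
  · refine ⟨x, (hp0 x).2 (Submodule.mem_sup_right hx), ?_⟩
    rw [hχ (Submodule.mem_sup_left hx), map_zero, sub_zero]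
  · refine ⟨H, (hp0 H).2 (Submodule.mem_sup_left H.2), ?_⟩
    have : q H = H := Submodule.projectionOnto_apply_left _ H
    rw [LinearMap.comp_apply, this]

/-- For a Dynkin Borel subalgebra, a nonempty sum of positive roots is nonzero. -/
theorem sum_ne_zero_of_isDynkin (hD : S.IsDynkin) {s : Multiset (Module.Dual K S.h)}
    (hs : ∀ β ∈ s, β ∈ S.pos) (hs0 : s ≠ 0) : s.sum ≠ 0 := by
  intro h0
  obtain ⟨β, hβ⟩ := Multiset.exists_mem_of_ne_zero hs0
  have hsimple : {α | S.IsSimpleRoot α} = ∅ := by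
    refine Set.eq_empty_of_forall_notMem fun α hα => hα.2 ⟨α ::ₘ s, ?_, ?_, ?_⟩
    · rw [Multiset.card_cons]
      have := Multiset.card_pos.2 hs0
      omega
    · intro γ hγ
      rcases Multiset.mem_cons.1 hγ with rfl | hγ
      · exact hα.1
      · exact hs γ hγ
    · rw [Multiset.sum_cons, h0, add_zero]
  have hb : S.b = S.h := by
    have hD' : S.b = _ := hD
    rw [hsimple, Set.biUnion_empty, Set.union_empty, LieSubalgebra.lieSpan_eq] at hD'
    exact hD'
  have hle : adWeightSpace K g S.h β ≤ adWeightSpace K g S.h 0 := by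
    have hb' := S.b_eq
    rw [hb] at hb'
    rw [adWeightSpace_zero]
    exact ((le_biSup (adWeightSpace K g S.h) (hs β hβ)).trans le_sup_right).trans hb'.ge
  exact (S.pos_root β (hs β hβ)).2
    (disjoint_self.1 ((S.h_indep.pairwiseDisjoint (ne_zero_of_mem_pos (hs β hβ))).mono_right hle))

lemma wle_refl (lam : Module.Dual K S.h) : S.wle lam lam :=
  ⟨0, fun _ h => absurd h (Multiset.notMem_zero _), by rw [sub_self, Multiset.sum_zero]⟩

lemma wle_trans {a b c : Module.Dual K S.h} (hab : S.wle a b) (hbc : S.wle b c) : S.wle a c := by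
  obtain ⟨s, hs, h1⟩ := hab
  obtain ⟨t, ht, h2⟩ := hbc
  refine ⟨s + t, fun β hβ => (Multiset.mem_add.1 hβ).elim (hs β) (ht β), ?_⟩
  rw [Multiset.sum_add, ← h1, ← h2]
  abel

lemma wle_antisymm (hD : S.IsDynkin) {a b : Module.Dual K S.h} (hab : S.wle a b)
    (hba : S.wle b a) : a = b := by
  obtain ⟨s, hs, h1⟩ := hab
  obtain ⟨t, ht, h2⟩ := hba
  by_contra hne
  refine sum_ne_zero_of_isDynkin hD (s := s + t)
    (fun β hβ => (Multiset.mem_add.1 hβ).elim (hs β) (ht β)) (fun h0 => hne ?_) ?_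
  · have hs0 : s = 0 := (add_eq_zero.1 h0).1
    rw [hs0, Multiset.sum_zero, sub_eq_zero] at h1
    exact h1.symm
  · rw [Multiset.sum_add, ← h1, ← h2]
    abel

lemma wle_add_negRoot {ν lam α : Module.Dual K S.h} (h : S.wle ν lam) (hα : α ∈ S.negRoots) :
    S.wle (ν + α) lam :=
  wle_trans ⟨{-α}, fun β hβ => Multiset.mem_singleton.1 hβ ▸ neg_mem_pos hα, by
    rw [Multiset.sum_singleton]; abel⟩ h

lemma add_negRoot_ne (hD : S.IsDynkin) {ν lam α : Module.Dual K S.h} (h : S.wle ν lam)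
    (hα : α ∈ S.negRoots) : ν + α ≠ lam := by
  rintro rfl
  have := wle_antisymm hD h (wle_add_negRoot (wle_refl ν) hα)
  exact hα.1.1 (left_eq_add.1 this)

end Roots

end Setup

namespace Setup

section WeightModules

open UniversalEnvelopingAlgebra

variable {K : Type} [Field K] [IsAlgClosed K] [CharZero K]
variable {g : Type} [LieRing g] [LieAlgebra K g]
variable {S : Setup K g}
variable {M : Type} [AddCommGroup M] [Module K M] [Module (Env K g) M]
  [IsScalarTower K (Env K g) M]
variable {M' : Type} [AddCommGroup M'] [Module K M'] [Module (Env K g) M']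
  [IsScalarTower K (Env K g) M']

lemma algebraMap_env_smul (c : K) (m : M) : algebraMap K (Env K g) c • m = c • m :=
  algebraMap_smul (Env K g) c m

/-- The components of a sum of weight vectors lie in any subspace stable under `h` which
contains the sum. -/
lemma mem_of_sum_mem {N : Submodule K M} (hN : ∀ H ∈ S.h, ∀ n ∈ N, ι K H • n ∈ N)
    (s : Finset (Module.Dual K S.h)) (x : Module.Dual K S.h → M)
    (hx : ∀ ν ∈ s, x ν ∈ S.wtSpace M ν) (hs : ∑ ν ∈ s, x ν ∈ N) : ∀ ν ∈ s, x ν ∈ N := by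
  classical
  induction s using Finset.induction_on generalizing x with
  | empty => intro ν hν; exact absurd hν (Finset.notMem_empty ν)
  | insert a s ha ih =>
    have key (ν : Module.Dual K S.h) (hν : ν ∈ s) : x ν ∈ N := by
      have hne : ν ≠ a := fun h => ha (h ▸ hν)
      obtain ⟨H, hH⟩ : ∃ H, ν H ≠ a H := by
        by_contra! h
        exact hne (LinearMap.ext h)
      have := ih (fun β => (β H - a H) • x β)
        (fun β hβ => Submodule.smul_mem _ _ (hx β (Finset.mem_insert_of_mem hβ))) (by
          have h1 : ι K (H : g) • ∑ β ∈ insert a s, x β - a H • ∑ β ∈ insert a s, x β ∈ N :=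
            sub_mem (hN H H.2 _ hs) (N.smul_mem _ hs)
          rw [Finset.smul_sum, Finset.smul_sum, ← Finset.sum_sub_distrib,
            Finset.sum_insert ha, hx a (Finset.mem_insert_self a s) H, sub_self, zero_add] at h1
          convert h1 using 1
          refine Finset.sum_congr rfl fun β hβ => ?_
          rw [hx β (Finset.mem_insert_of_mem hβ) H, sub_smul]) ν hν
      exact (N.smul_mem_iff (sub_ne_zero.2 hH)).1 this
    intro ν hν
    rcases Finset.mem_insert.1 hν with rfl | hν
    · rw [Finset.sum_insert ha] at hs
      exact (N.add_mem_iff_left (N.sum_mem key)).1 hs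
    · exact key ν hν

lemma mem_of_add_mem {N : Submodule K M} (hN : ∀ H ∈ S.h, ∀ n ∈ N, ι K H • n ∈ N)
    {a : Module.Dual K S.h} {A : Set (Module.Dual K S.h)} (haA : a ∉ A) {x y : M}
    (hx : x ∈ S.wtSpace M a) (hy : y ∈ ⨆ ν ∈ A, S.wtSpace M ν) (hxy : x + y ∈ N) : x ∈ N := by
  classical
  obtain ⟨f, hf, rfl⟩ := (Submodule.mem_iSup_iff_exists_finsupp _ _).1 hy
  have hfa : f a = 0 := by
    have := hf a
    simpa [haA] using this
  have hf' (ν : Module.Dual K S.h) : f ν ∈ S.wtSpace M ν := by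
    by_cases hν : ν ∈ A
    · simpa [hν] using hf ν
    · have := hf ν
      simp only [hν, iSup_neg, not_false_eq_true, Submodule.mem_bot] at this
      rw [this]
      exact zero_mem _
  have ha : a ∉ f.support := fun h => Finsupp.mem_support_iff.1 h hfa
  have hsum : x + f.sum (fun _ xi => xi) =
      ∑ ν ∈ insert a f.support, Function.update f a x ν := by
    rw [Finset.sum_insert ha, Function.update_self, Finsupp.sum]
    refine congrArg _ (Finset.sum_congr rfl fun β hβ => ?_)
    rw [Function.update_of_ne (ne_of_mem_of_not_mem hβ ha)]
  have := mem_of_sum_mem hN (insert a f.support) (Function.update f a x) (fun ν _ => by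
    by_cases h : ν = a
    · subst h
      rwa [Function.update_self]
    · rw [Function.update_of_ne h]
      exact hf' ν) (hsum ▸ hxy) a (Finset.mem_insert_self _ _)
  rwa [Function.update_self] at this

lemma eq_zero_of_mem_iSup {a : Module.Dual K S.h} {A : Set (Module.Dual K S.h)} (haA : a ∉ A)
    {x : M} (hx : x ∈ S.wtSpace M a) (hy : x ∈ ⨆ ν ∈ A, S.wtSpace M ν) : x = 0 :=
  (Submodule.mem_bot K).1 <| mem_of_add_mem (N := ⊥)
    (fun H _ n hn => by rw [(Submodule.mem_bot K).1 hn, smul_zero]; exact zero_mem _) haA hx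
    (neg_mem hy) (by rw [add_neg_cancel]; exact zero_mem _)

lemma map_mem_wtSpace (f : M →ₗ[Env K g] M') {ν : Module.Dual K S.h} {x : M}
    (hx : x ∈ S.wtSpace M ν) : f x ∈ S.wtSpace M' ν := fun H => by
  rw [← map_smul, hx H, ← algebraMap_env_smul (g := g), map_smul, algebraMap_env_smul]

lemma smul_mem_wtSpace {α ν : Module.Dual K S.h} {y : g} {x : M}
    (hy : y ∈ adWeightSpace K g S.h α) (hx : x ∈ S.wtSpace M ν) :
    ι K y • x ∈ S.wtSpace M (ν + α) := fun H => by
  have h := congrArg (· • x) (ι_lie (k := K) (H : g) y)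
  simp only [sub_smul, mul_smul] at h
  rw [hx H, hy H, map_smul, smul_assoc, env_smul_comm, eq_sub_iff_add_eq] at h
  rw [← h, LinearMap.add_apply, add_smul, add_comm]

end WeightModules

section Verma

open UniversalEnvelopingAlgebra

variable {K : Type} [Field K] [IsAlgClosed K] [CharZero K]
variable {g : Type} [LieRing g] [LieAlgebra K g]
variable {S : Setup K g} (lam : Module.Dual K S.h)

variable (S) in
/-- The canonical generator of the Verma module. -/
def vermaGen : S.Verma lam := Submodule.Quotient.mk 1

lemma smul_vermaGen (u : Env K g) : u • S.vermaGen lam = Submodule.Quotient.mk u := by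
  rw [vermaGen, ← Submodule.Quotient.mk_smul, smul_eq_mul, mul_one]

lemma vermaGen_ne_zero : S.vermaGen lam ≠ 0 := fun h =>
  one_notMem_vermaIdeal lam ((Submodule.Quotient.mk_eq_zero _).1 h)

lemma nplus_smul_vermaGen {x : g} (hx : x ∈ S.nplus) : ι K x • S.vermaGen lam = 0 := by
  rw [smul_vermaGen, Submodule.Quotient.mk_eq_zero]
  exact Submodule.subset_span (Or.inl ⟨x, hx, rfl⟩)

lemma vermaGen_mem : S.vermaGen lam ∈ S.wtSpace (S.Verma lam) lam := fun H => by
  rw [← algebraMap_env_smul (g := g), smul_vermaGen, smul_vermaGen, Submodule.Quotient.eq]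
  exact Submodule.subset_span (Or.inr ⟨H, rfl⟩)

lemma eq_top_of_vermaGen_mem {N : Submodule (Env K g) (S.Verma lam)} (h : S.vermaGen lam ∈ N) :
    N = ⊤ := Submodule.eq_top_iff'.2 fun x => by
  obtain ⟨u, rfl⟩ := Submodule.Quotient.mk_surjective _ x
  rw [← smul_vermaGen]
  exact N.smul_mem u h

variable (S) in
/-- The weights strictly below `lam`. -/
def weightsBelow : Set (Module.Dual K S.h) := {ν | S.wle ν lam ∧ ν ≠ lam}

variable (S) in
/-- The sum of the weight spaces of the Verma module with weights strictly below `lam`. -/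
def lowerVerma : Submodule K (S.Verma lam) :=
  ⨆ ν ∈ S.weightsBelow lam, S.wtSpace (S.Verma lam) ν

variable {lam}

lemma lower_mem (hD : S.IsDynkin) {y : g} (hy : y ∈ S.nminus) {ν : Module.Dual K S.h}
    (hν : S.wle ν lam) {x : S.Verma lam} (hx : x ∈ S.wtSpace (S.Verma lam) ν) :
    ι K y • x ∈ S.lowerVerma lam := by
  let T : g →ₗ[K] S.Verma lam :=
    { toFun := fun y => ι K y • x
      map_add' := fun a b => by rw [map_add, add_smul]
      map_smul' := fun c a => by rw [map_smul, smul_assoc, RingHom.id_apply] }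
  exact (iSup₂_le fun α hα y hy => Submodule.mem_iSup_of_mem (ν + α) (Submodule.mem_iSup_of_mem
    ⟨wle_add_negRoot hν hα, add_negRoot_ne hD hν hα⟩ (smul_mem_wtSpace hy hx)) :
    S.weightSum S.negRoots ≤ (S.lowerVerma lam).comap T) hy

lemma lower_mem' (hD : S.IsDynkin) {y : g} (hy : y ∈ S.nminus) {x : S.Verma lam}
    (hx : x ∈ S.lowerVerma lam) : ι K y • x ∈ S.lowerVerma lam := by
  let T : S.Verma lam →ₗ[K] S.Verma lam :=
    { toFun := fun x => ι K y • x
      map_add' := fun a b => smul_add _ a b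
      map_smul' := fun c a => env_smul_comm c _ a }
  exact (iSup₂_le fun ν hν x hx => lower_mem hD hy hν.1 hx :
    S.lowerVerma lam ≤ (S.lowerVerma lam).comap T) hx

theorem span_sup_lowerVerma (hD : S.IsDynkin) :
    Submodule.span K {S.vermaGen lam} ⊔ S.lowerVerma lam = ⊤ := by
  let ρ : g →ₗ[K] Module.End K (S.Verma lam) := LinearMap.mk₂ K (fun y x => ι K y • x)
    (fun a b x => by rw [map_add, add_smul]) (fun c a x => by rw [map_smul, smul_assoc])
    (fun a x y => smul_add _ x y) (fun c a x => env_smul_comm c _ x)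
  obtain ⟨X, hvX, hXW, hX⟩ := exists_stable_submodule ρ
    (fun x y v => by
      change ι K ⁅x, y⁆ • v = ι K x • ι K y • v - ι K y • ι K x • v
      rw [ι_lie, sub_smul, mul_smul, mul_smul])
    S.nminus.toSubmodule (S.h.toSubmodule ⊔ S.nplus) weightSum_eq_top (S.vermaGen lam)
    (fun y hy => by
      obtain ⟨H, hH, n, hn, rfl⟩ := Submodule.mem_sup.1 hy
      refine ⟨lam ⟨H, hH⟩, ?_⟩
      change ι K (H + n) • S.vermaGen lam = lam ⟨H, hH⟩ • S.vermaGen lam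
      rw [map_add, add_smul, nplus_smul_vermaGen lam hn, add_zero]
      exact vermaGen_mem lam ⟨H, hH⟩)
    (Submodule.span K {S.vermaGen lam} ⊔ S.lowerVerma lam)
    (Submodule.mem_sup_left (Submodule.mem_span_singleton_self _))
    (fun y hy w hw => by
      obtain ⟨v, hv, z, hz, rfl⟩ := Submodule.mem_sup.1 hw
      obtain ⟨c, rfl⟩ := Submodule.mem_span_singleton.1 hv
      change ι K y • (c • S.vermaGen lam + z) ∈ _
      rw [smul_add]
      exact Submodule.mem_sup_right (add_mem
        (lower_mem hD hy (wle_refl lam) (Submodule.smul_mem _ c (vermaGen_mem lam)))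
        (lower_mem' hD hy hz)))
  rw [eq_top_iff]
  refine le_trans (fun x _ => ?_) hXW
  obtain ⟨u, rfl⟩ := Submodule.Quotient.mk_surjective _ x
  rw [← smul_vermaGen]
  induction u using uea_induction with
  | h1 => rwa [one_smul]
  | hmul x u hu => rw [mul_smul]; exact hX x _ (hu trivial)
  | hadd u v hu hv => rw [add_smul]; exact add_mem (hu trivial) (hv trivial)
  | hsmul c u hu => rw [smul_assoc]; exact X.smul_mem c (hu trivial)

lemma vermaGen_notMem_lowerVerma : S.vermaGen lam ∉ S.lowerVerma lam := fun h =>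
  vermaGen_ne_zero lam
    (eq_zero_of_mem_iSup (A := S.weightsBelow lam) (fun h => h.2 rfl) (vermaGen_mem lam) h)

lemma mem_lowerVerma_of_ne_top (hD : S.IsDynkin) {N : Submodule (Env K g) (S.Verma lam)}
    (hN : N ≠ ⊤) {x : S.Verma lam} (hx : x ∈ N) : x ∈ S.lowerVerma lam := by
  obtain ⟨v, hv, z, hz, rfl⟩ := Submodule.mem_sup.1
    ((span_sup_lowerVerma hD (lam := lam)).symm ▸ Submodule.mem_top :
      x ∈ Submodule.span K {S.vermaGen lam} ⊔ S.lowerVerma lam)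
  obtain ⟨c, rfl⟩ := Submodule.mem_span_singleton.1 hv
  by_cases hc : c = 0
  · rwa [hc, zero_smul, zero_add]
  · refine absurd (eq_top_of_vermaGen_mem lam ?_) hN
    have := mem_of_add_mem (N := N.restrictScalars K) (A := S.weightsBelow lam)
      (fun H _ n hn => N.smul_mem _ hn) (fun h => h.2 rfl)
      (Submodule.smul_mem _ c (vermaGen_mem lam)) hz hx
    exact ((N.restrictScalars K).smul_mem_iff hc).1 this

lemma maxSub_le (hD : S.IsDynkin) {x : S.Verma lam} (hx : x ∈ S.maxSub lam) :
    x ∈ S.lowerVerma lam := by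
  let Z : Submodule (Env K g) (S.Verma lam) :=
    { carrier := {x | ∀ u : Env K g, u • x ∈ S.lowerVerma lam}
      add_mem' := fun ha hb u => by rw [smul_add]; exact add_mem (ha u) (hb u)
      zero_mem' := fun u => by rw [smul_zero]; exact zero_mem _
      smul_mem' := fun c x hx u => by rw [smul_smul]; exact hx _ }
  have hle : S.maxSub lam ≤ Z := sSup_le fun N hN x hx u =>
    mem_lowerVerma_of_ne_top hD hN (N.smul_mem u hx)
  have := hle hx 1
  rwa [one_smul] at this

variable (S lam) in
/-- The canonical generator of the simple module. -/
def simpleGen : S.SimpleL lam := Submodule.Quotient.mk (S.vermaGen lam)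

lemma simpleGen_ne_zero (hD : S.IsDynkin) : S.simpleGen lam ≠ 0 := fun h =>
  vermaGen_notMem_lowerVerma (maxSub_le hD ((Submodule.Quotient.mk_eq_zero _).1 h))

lemma simpleGen_mem : S.simpleGen lam ∈ S.wtSpace (S.SimpleL lam) lam :=
  map_mem_wtSpace (S.maxSub lam).mkQ (vermaGen_mem lam)

theorem isSimpleModule_simpleL (hD : S.IsDynkin) : IsSimpleModule (Env K g) (S.SimpleL lam) := by
  rw [isSimpleModule_iff]
  have : Nontrivial (Submodule (Env K g) (S.SimpleL lam)) :=
    (Submodule.nontrivial_iff _).2 ⟨_, _, simpleGen_ne_zero hD⟩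
  refine ⟨fun N => ?_⟩
  by_cases hN : N.comap (S.maxSub lam).mkQ = ⊤
  · right
    rw [eq_top_iff, ← Submodule.range_mkQ (S.maxSub lam), LinearMap.range_le_iff_comap]
    exact hN
  · left
    rw [eq_bot_iff]
    intro x hx
    obtain ⟨y, rfl⟩ := Submodule.Quotient.mk_surjective _ x
    have : N.comap (S.maxSub lam).mkQ ≤ S.maxSub lam := le_sSup hN
    exact (Submodule.mem_bot _).2 ((Submodule.Quotient.mk_eq_zero _).2 (this hx))

lemma wle_of_mem_wtSpace (hD : S.IsDynkin) {ξ : Module.Dual K S.h} {x : S.SimpleL lam}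
    (hx : x ∈ S.wtSpace (S.SimpleL lam) ξ) (h0 : x ≠ 0) : S.wle ξ lam := by
  by_contra hξ
  refine h0 (eq_zero_of_mem_iSup (A := {ν | S.wle ν lam}) hξ hx ?_)
  obtain ⟨y, rfl⟩ := Submodule.Quotient.mk_surjective _ x
  obtain ⟨v, hv, z, hz, rfl⟩ := Submodule.mem_sup.1
    ((span_sup_lowerVerma hD (lam := lam)).symm ▸ Submodule.mem_top :
      y ∈ Submodule.span K {S.vermaGen lam} ⊔ S.lowerVerma lam)
  obtain ⟨c, rfl⟩ := Submodule.mem_span_singleton.1 hv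
  let f := (S.maxSub lam).mkQ.restrictScalars K
  change f _ ∈ _
  rw [map_add]
  refine add_mem (Submodule.mem_iSup_of_mem lam (Submodule.mem_iSup_of_mem (wle_refl lam)
    (map_mem_wtSpace _ (Submodule.smul_mem _ c (vermaGen_mem lam))))) ?_
  exact (iSup₂_le fun ν hν z hz => Submodule.mem_iSup_of_mem ν (Submodule.mem_iSup_of_mem hν.1
    (map_mem_wtSpace _ hz)) : S.lowerVerma lam ≤ (⨆ ν ∈ {ν | S.wle ν lam},
      S.wtSpace (S.SimpleL lam) ν).comap f) hz

theorem eq_of_simpleL_equiv (hD : S.IsDynkin) {ξ : Module.Dual K S.h}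
    (e : S.SimpleL ξ ≃ₗ[Env K g] S.SimpleL lam) : ξ = lam := by
  refine wle_antisymm hD ?_ ?_
  · exact wle_of_mem_wtSpace hD (map_mem_wtSpace e.toLinearMap simpleGen_mem)
      (e.map_ne_zero_iff.2 (simpleGen_ne_zero hD))
  · exact wle_of_mem_wtSpace hD (map_mem_wtSpace e.symm.toLinearMap simpleGen_mem)
      (e.symm.map_ne_zero_iff.2 (simpleGen_ne_zero hD))

end Verma

end Setup

section Chains

variable {α : Type*} [Lattice α] {k l : ℕ}

/-- The `i`-th step of `c` and the `j`-th step of `d` correspond to each other in the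
Schreier refinement of the two chains. -/
def Linked (c : Fin (k + 1) → α) (d : Fin (l + 1) → α) (i : Fin k) (j : Fin l) : Prop :=
  ¬ c i.succ ⊓ d j.succ ≤ (c i.castSucc ⊓ d j.succ) ⊔ (c i.succ ⊓ d j.castSucc)

lemma Linked.symm {c : Fin (k + 1) → α} {d : Fin (l + 1) → α} {i : Fin k} {j : Fin l}
    (h : Linked c d i j) : Linked d c j i := by
  rw [Linked, inf_comm, sup_comm, inf_comm (d j.castSucc), inf_comm (d j.succ)]
  exact h

lemma Linked.not_le {c : Fin (k + 1) → α} {d : Fin (l + 1) → α} {i : Fin k} {j : Fin l}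
    (h : Linked c d i j) : ¬ c i.succ ⊓ d j.succ ≤ c i.castSucc :=
  fun h' => h ((le_inf h' inf_le_right).trans le_sup_left)

variable [IsModularLattice α]

lemma linked_iff {c : Fin (k + 1) → α} {d : Fin (l + 1) → α} (hd : Monotone d)
    {i : Fin k} {j : Fin l} : Linked c d i j ↔
      ¬ (c i.succ ⊓ d j.succ) ⊔ c i.castSucc ≤ (c i.succ ⊓ d j.castSucc) ⊔ c i.castSucc := by
  rw [Linked, not_iff_not]
  constructor
  · intro h
    refine sup_le (h.trans ?_) le_sup_right
    rw [sup_comm]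
    exact sup_le_sup_left inf_le_left _
  · intro h
    have h1 : c i.succ ⊓ d j.succ ≤
        ((c i.succ ⊓ d j.castSucc) ⊔ c i.castSucc) ⊓ d j.succ :=
      le_inf (le_sup_left.trans h) inf_le_right
    rwa [sup_inf_assoc_of_le _ (inf_le_right.trans (hd j.castSucc_le_succ)), sup_comm] at h1

lemma exists_linked [BoundedOrder α] {c : Fin (k + 1) → α} {d : Fin (l + 1) → α}
    (hd : Monotone d) (h0 : d 0 = ⊥) (h1 : d (Fin.last l) = ⊤) {i : Fin k}
    (hi : ¬ c i.succ ≤ c i.castSucc) : ∃ j, Linked c d i j := by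
  by_contra! h
  simp only [linked_iff hd, not_not] at h
  have key (m : Fin (l + 1)) : (c i.succ ⊓ d m) ⊔ c i.castSucc ≤ c i.castSucc := by
    induction m using Fin.induction with
    | zero => rw [h0, inf_bot_eq, bot_sup_eq]
    | succ j ih => exact (h j).trans ih
  have := key (Fin.last l)
  rw [h1, inf_top_eq] at this
  exact hi (le_sup_left.trans this)

lemma Linked.inf_le {c : Fin (k + 1) → α} {d : Fin (l + 1) → α} (hd : Monotone d)
    {i : Fin k} {j : Fin l} (hi : c i.castSucc ⋖ c i.succ) (h : Linked c d i j) :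
    c i.succ ⊓ d j.castSucc ≤ c i.castSucc := by
  rcases hi.eq_or_eq (le_sup_right : c i.castSucc ≤ (c i.succ ⊓ d j.castSucc) ⊔ c i.castSucc)
    (sup_le inf_le_left hi.le) with h' | h'
  · exact sup_eq_right.1 h'
  · refine absurd ?_ ((linked_iff hd).1 h)
    rw [h']
    exact sup_le inf_le_left hi.le

lemma Linked.le_of_linked {c : Fin (k + 1) → α} {d : Fin (l + 1) → α} (hd : Monotone d)
    {i : Fin k} {j j' : Fin l} (hi : c i.castSucc ⋖ c i.succ) (h : Linked c d i j)
    (h' : Linked c d i j') : j ≤ j' := by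
  by_contra! hlt
  refine h'.not_le ((inf_le_inf_left _ (hd ?_)).trans (h.inf_le hd hi))
  rw [Fin.le_def, Fin.val_succ, Fin.val_castSucc]
  exact hlt

end Chains

section SimpleQuotients

variable {R X A B : Type*} [Ring R] [AddCommGroup X] [Module R X] [AddCommGroup A] [Module R A]
  [AddCommGroup B] [Module R B]

lemma nonempty_equiv_of_ker_le [IsSimpleModule R A] [IsSimpleModule R B] (q : X →ₗ[R] A)
    (p : X →ₗ[R] B) (hq : q ≠ 0) (h : p.ker ≤ q.ker) : Nonempty (B ≃ₗ[R] A) := by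
  have hp : p ≠ 0 := by
    rintro rfl
    rw [LinearMap.ker_zero, top_le_iff, LinearMap.ker_eq_top] at h
    exact hq h
  have hps := LinearMap.surjective_of_ne_zero hp
  have hqs := LinearMap.surjective_of_ne_zero hq
  have hker : p.ker = q.ker :=
    ((LinearMap.isCoatom_ker_of_surjective hps).le_iff_eq
      (LinearMap.isCoatom_ker_of_surjective hqs).1).1 h |>.symm
  exact ⟨(p.quotKerEquivOfSurjective hps).symm ≪≫ₗ Submodule.quotEquivOfEq _ _ hker ≪≫ₗ
    q.quotKerEquivOfSurjective hqs⟩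

end SimpleQuotients

namespace Setup

section Multiplicity

open UniversalEnvelopingAlgebra

variable {K : Type} [Field K] [IsAlgClosed K] [CharZero K]
variable {g : Type} [LieRing g] [LieAlgebra K g]
variable {S : Setup K g}
variable {M : Type} [AddCommGroup M] [Module K M] [Module (Env K g) M]
  [IsScalarTower K (Env K g) M]

lemma iSup_wtSpace_submodule (hM : ⨆ ν, S.wtSpace M ν = ⊤) (N : Submodule (Env K g) M) :
    ⨆ ν, S.wtSpace N ν = ⊤ := by
  refine Submodule.eq_top_iff'.2 fun x => ?_
  obtain ⟨f, hf, hfx⟩ := (Submodule.mem_iSup_iff_exists_finsupp _ _).1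
    (hM.symm ▸ Submodule.mem_top : (x : M) ∈ ⨆ ν, S.wtSpace M ν)
  have hfN := mem_of_sum_mem (N := N.restrictScalars K) (fun H _ n hn => N.smul_mem _ hn)
    f.support f (fun ν _ => hf ν) (by
      change f.sum (fun _ y => y) ∈ N
      rw [hfx]
      exact x.2)
  have hx : x = ∑ ν ∈ f.support.attach, ⟨f ν, hfN ν ν.2⟩ := Subtype.ext <| by
    rw [AddSubmonoidClass.coe_finsetSum, ← hfx, Finsupp.sum, ← Finset.sum_attach]
  rw [hx]
  exact Submodule.sum_mem _ fun ν _ => Submodule.mem_iSup_of_mem (ν : Module.Dual K S.h)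
    fun H => Subtype.ext (hf ν H)

lemma wtSpace_ne_bot_of_ker_le {mu : Module.Dual K S.h} (hD : S.IsDynkin)
    (hM : ⨆ ν, S.wtSpace M ν = ⊤) {B : Type} [AddCommGroup B] [Module K B] [Module (Env K g) B]
    [IsScalarTower K (Env K g) B] (q : M →ₗ[Env K g] S.SimpleL mu) (hq : Function.Surjective q)
    (p : M →ₗ[Env K g] B) (h : p.ker ≤ q.ker) : S.wtSpace B mu ≠ ⊥ := by
  intro hB
  obtain ⟨x, hx⟩ := hq (S.simpleGen mu)
  refine simpleGen_ne_zero (lam := mu) hD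
    (eq_zero_of_mem_iSup (A := {mu}ᶜ) (fun h => h rfl) simpleGen_mem ?_)
  rw [← hx]
  refine (iSup_le fun ν y hy => ?_ : ⨆ ν, S.wtSpace M ν ≤
    (⨆ ν ∈ ({mu}ᶜ : Set (Module.Dual K S.h)), S.wtSpace (S.SimpleL mu) ν).comap
      (q.restrictScalars K)) (hM.symm ▸ Submodule.mem_top)
  change q y ∈ ⨆ ν ∈ ({mu}ᶜ : Set (Module.Dual K S.h)), S.wtSpace (S.SimpleL mu) ν
  by_cases hν : ν = mu
  · subst hν
    have hy' : p y = 0 := (Submodule.mem_bot K).1 (hB ▸ map_mem_wtSpace p hy)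
    rw [show q y = 0 from h hy']
    exact zero_mem _
  · exact Submodule.mem_iSup_of_mem ν (Submodule.mem_iSup_of_mem hν (map_mem_wtSpace q hy))

lemma CompSeries.covBy_of_equiv (hD : S.IsDynkin) {lam nu mu : Module.Dual K S.h}
    (T : S.CompSeries lam nu M) (i : Fin T.k)
    (e : T.quot i ≃ₗ[Env K g] S.SimpleL mu) : T.c i.castSucc ⋖ T.c i.succ :=
  have := isSimpleModule_simpleL hD (lam := mu)
  (covBy_iff_quot_is_simple (T.mono i.castSucc_le_succ)).2 (IsSimpleModule.congr e)

lemma CompSeries.counted_of_linked (hD : S.IsDynkin) (hM : S.InO M)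
    {mu lam₁ nu₁ lam₂ nu₂ : Module.Dual K S.h} (h₂ : S.wle lam₂ mu) (h₂' : S.wle mu nu₂)
    (T₁ : S.CompSeries lam₁ nu₁ M) (T₂ : S.CompSeries lam₂ nu₂ M) {i : Fin T₁.k} {j : Fin T₂.k}
    (hij : Linked T₁.c T₂.c i j) (e : T₁.quot i ≃ₗ[Env K g] S.SimpleL mu) :
    j ∈ T₂.J ∧ Nonempty (T₂.quot j ≃ₗ[Env K g] S.SimpleL mu) := by
  have hi := T₁.covBy_of_equiv hD i e
  have hle := hij.inf_le T₂.mono hi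
  have hsimple := isSimpleModule_simpleL hD (lam := mu)
  let X : Submodule (Env K g) M := T₁.c i.succ ⊓ T₂.c j.succ
  let q : X →ₗ[Env K g] S.SimpleL mu := e.toLinearMap ∘ₗ
    (Submodule.mkQ _) ∘ₗ Submodule.inclusion (inf_le_left : X ≤ T₁.c i.succ)
  let p : X →ₗ[Env K g] T₂.quot j :=
    (Submodule.mkQ _) ∘ₗ Submodule.inclusion (inf_le_right : X ≤ T₂.c j.succ)
  have hq0 (x : X) : q x = 0 ↔ (x : M) ∈ T₁.c i.castSucc :=
    e.map_eq_zero_iff.trans (Submodule.Quotient.mk_eq_zero _)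
  have hp0 (x : X) : p x = 0 ↔ (x : M) ∈ T₂.c j.castSucc := Submodule.Quotient.mk_eq_zero _
  have hq : q ≠ 0 := fun h => hij.not_le fun x hx =>
    (hq0 ⟨x, hx⟩).1 (by rw [h, LinearMap.zero_apply])
  have hker : p.ker ≤ q.ker := fun x hx => (hq0 x).2 (hle ⟨x.2.1, (hp0 x).1 hx⟩)
  have hcase {ξ : Module.Dual K S.h} (f : T₂.quot j ≃ₗ[Env K g] S.SimpleL ξ) :
      Nonempty (T₂.quot j ≃ₗ[Env K g] S.SimpleL mu) := by
    have := isSimpleModule_simpleL hD (lam := ξ)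
    have : IsSimpleModule (Env K g) (T₂.quot j) := IsSimpleModule.congr f
    exact nonempty_equiv_of_ker_le q p hq hker
  by_cases hj : j ∈ T₂.J
  · obtain ⟨ξ, _, _, ⟨f⟩⟩ := T₂.rel j hj
    exact ⟨hj, hcase f⟩
  · exfalso
    rcases T₂.irrel j hj with hw | ⟨ξ, _, _, hξ, ⟨f⟩⟩
    · exact wtSpace_ne_bot_of_ker_le hD (iSup_wtSpace_submodule hM.span X) q
        (LinearMap.surjective_of_ne_zero hq) p hker (hw mu h₂ h₂')
    · obtain ⟨f'⟩ := hcase f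
      exact hξ (eq_of_simpleL_equiv hD (f.symm ≪≫ₗ f') ▸ h₂')

lemma CompSeries.mult_le (hD : S.IsDynkin) (hM : S.InO M)
    {mu lam₁ nu₁ lam₂ nu₂ : Module.Dual K S.h} (h₂ : S.wle lam₂ mu) (h₂' : S.wle mu nu₂)
    (T₁ : S.CompSeries lam₁ nu₁ M) (T₂ : S.CompSeries lam₂ nu₂ M) : T₁.mult mu ≤ T₂.mult mu := by
  have hex (i : {i : Fin T₁.k // i ∈ T₁.J ∧ Nonempty (T₁.quot i ≃ₗ[Env K g] S.SimpleL mu)}) :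
      ∃ j : {j : Fin T₂.k // j ∈ T₂.J ∧ Nonempty (T₂.quot j ≃ₗ[Env K g] S.SimpleL mu)},
        Linked T₁.c T₂.c i j := by
    obtain ⟨i, hi, ⟨e⟩⟩ := i
    obtain ⟨j, hj⟩ := exists_linked (c := T₁.c) T₂.mono T₂.bot T₂.top
      (T₁.covBy_of_equiv hD i e).lt.not_ge
    exact ⟨⟨j, counted_of_linked hD hM h₂ h₂' T₁ T₂ hj e⟩, hj⟩
  choose f hf using hex
  refine Nat.card_le_card_of_injective f fun i i' hii' => Subtype.ext ?_
  obtain ⟨e⟩ := (f i).2.2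
  have hcov := T₂.covBy_of_equiv hD _ e
  have h1 := (hf i).symm
  have h2 := (hf i').symm
  rw [← hii'] at h2
  exact le_antisymm (h1.le_of_linked T₁.mono hcov h2) (h2.le_of_linked T₁.mono hcov h1)

end Multiplicity

end Setup

/-- The number of times `L(mu)` occurs in a composition series of
`M ∈ O-bar` with bounds `lam ≼ mu ≼ nu` is independent of the choice of the composition
series and of the bounds. -/
theorem compSeries_multiplicity_well_defined
    (K : Type) [Field K] [IsAlgClosed K] [CharZero K]
    (g : Type) [LieRing g] [LieAlgebra K g] (S : Setup K g) (hDynkin : S.IsDynkin)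
    (M : Type) [AddCommGroup M] [Module K M] [Module (Env K g) M]
    [IsScalarTower K (Env K g) M] (hM : S.InO M)
    (mu lam₁ nu₁ lam₂ nu₂ : Module.Dual K S.h)
    (h₁ : S.wle lam₁ mu) (h₁' : S.wle mu nu₁) (h₂ : S.wle lam₂ mu) (h₂' : S.wle mu nu₂)
    (T₁ : S.CompSeries lam₁ nu₁ M) (T₂ : S.CompSeries lam₂ nu₂ M) :
    T₁.mult mu = T₂.mult mu := by
  exact le_antisymm (Setup.CompSeries.mult_le hDynkin hM h₂ h₂' T₁ T₂)
    (Setup.CompSeries.mult_le hDynkin hM h₁ h₁' T₂ T₁)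

end Paper
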